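/- arXiv:0805.2043 — 2 statements merged into one kernel-verified Lean document; each statement's English description precedes it below -/
import Mathlib

section
/- Let E be a minimal Banach space not containing an isomorphic copy of ℓ₁. Let X be a Banach space and Y a closed subspace of X such that the quotient X/Y has the Schur property. If Y does not contain an isomorphic copy of E, then neither does X. -/
open Filter Topology MeasureTheory

noncomputable section

/-! ### The Cantor set and the space `C(2^ℕ)` -/

/-- The Cantor set `2^ℕ`. -/
abbrev CantorSet : Type := ℕ → Bool

/-- The Banach space `C(2^ℕ)` of continuous real-valued functions on the Cantor set. -/
abbrev CantorC : Type := C(CantorSet, ℝ)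

/-! ### The standard Borel space `SB` of separable Banach spaces -/

/-- `SB`: the set of closed linear subspaces of `C(2^ℕ)`. -/
def SB : Type := {Y : Submodule ℝ CantorC // IsClosed (Y : Set CantorC)}

/-- The Effros-Borel σ-algebra on `SB`, generated by the sets
`{Y : Y ∩ U ≠ ∅}` for `U` open in `C(2^ℕ)`. -/
instance : MeasurableSpace SB :=
  MeasurableSpace.generateFrom
    {A : Set SB | ∃ U : Set CantorC, IsOpen U ∧ A = {Y : SB | ((Y.1 : Set CantorC) ∩ U).Nonempty}}

/-- A subset of a standard Borel space is analytic if it is the image of a Borel map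
from the Baire space `ℕ^ℕ`. -/
def IsAnalyticIn {α : Type*} [MeasurableSpace α] (A : Set α) : Prop :=
  ∃ f : (ℕ → ℕ) → α, Measurable f ∧ A = Set.range f

/-! ### Embeddings, isomorphisms, universality -/

/-- `X` embeds isomorphically into `Y`: there is a bounded linear map which is
bounded below, i.e. an isomorphism onto its range. -/
def Embeds (X Y : Type*) [SeminormedAddCommGroup X] [NormedSpace ℝ X]
    [SeminormedAddCommGroup Y] [NormedSpace ℝ Y] : Prop :=
  ∃ (T : X →L[ℝ] Y) (c : ℝ), 0 < c ∧ ∀ x : X, c * ‖x‖ ≤ ‖T x‖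

/-- `X` embeds isometrically into `Y` (i.e. `Y` contains an isometric copy of `X`). -/
def EmbedsIsometrically (X Y : Type*) [SeminormedAddCommGroup X] [NormedSpace ℝ X]
    [SeminormedAddCommGroup Y] [NormedSpace ℝ Y] : Prop :=
  Nonempty (X →ₗᵢ[ℝ] Y)

/-- `X` and `Y` are isomorphic Banach spaces (linearly homeomorphic). -/
def IsomorphicTo (X Y : Type*) [SeminormedAddCommGroup X] [NormedSpace ℝ X]
    [SeminormedAddCommGroup Y] [NormedSpace ℝ Y] : Prop :=
  Nonempty (X ≃L[ℝ] Y)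

/-- The class `NU ⊆ SB` of non-universal spaces: those `X ∈ SB` which do not contain
an isomorphic copy of `C(2^ℕ)` (equivalently, are not universal for all separable
Banach spaces). -/
def NU : Set SB := {Y : SB | ¬ Embeds CantorC Y.1}

/-- The class `NC_X ⊆ SB` of all `Y ∈ SB` containing no isomorphic copy of `X`. -/
def NCin (X : Type*) [SeminormedAddCommGroup X] [NormedSpace ℝ X] : Set SB :=
  {Y : SB | ¬ Embeds X Y.1}

/-! ### Schauder bases -/

/-- `x` is a Schauder basis of `E`: every vector has a unique representation as a
norm convergent series `Σ aₙ • xₙ`. -/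
def IsSchauderBasis {E : Type*} [SeminormedAddCommGroup E] [NormedSpace ℝ E]
    (x : ℕ → E) : Prop :=
  ∀ y : E, ∃! a : ℕ → ℝ,
    Tendsto (fun m => ∑ n ∈ Finset.range m, a n • x n) atTop (𝓝 y)

/-- `E` has a Schauder basis. -/
def HasSchauderBasis (E : Type*) [SeminormedAddCommGroup E] [NormedSpace ℝ E] : Prop :=
  ∃ x : ℕ → E, IsSchauderBasis x

/-- `x` is a monotone basis sequence: initial-segment projections have norm at most 1. -/
def IsMonotoneSeq {E : Type*} [SeminormedAddCommGroup E] [NormedSpace ℝ E]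
    (x : ℕ → E) : Prop :=
  ∀ (a : ℕ → ℝ) (k m : ℕ), k ≤ m →
    ‖∑ n ∈ Finset.range k, a n • x n‖ ≤ ‖∑ n ∈ Finset.range m, a n • x n‖

/-- `x` is a bi-monotone sequence: interval projections have norm at most 1. -/
def IsBimonotoneSeq {E : Type*} [SeminormedAddCommGroup E] [NormedSpace ℝ E]
    (x : ℕ → E) : Prop :=
  ∀ (a : ℕ → ℝ) (j k m : ℕ), j ≤ k → k ≤ m →
    ‖∑ n ∈ Finset.Ico j k, a n • x n‖ ≤ ‖∑ n ∈ Finset.range m, a n • x n‖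

/-- `x` is a Schauder basic sequence: it is a Schauder basis of its closed linear span. -/
def IsSchauderBasicSeq {E : Type*} [NormedAddCommGroup E] [NormedSpace ℝ E]
    (x : ℕ → E) : Prop :=
  ∀ y ∈ (Submodule.span ℝ (Set.range x)).topologicalClosure,
    ∃! a : ℕ → ℝ,
      Tendsto (fun m => ∑ n ∈ Finset.range m, a n • x n) atTop (𝓝 y)

/-! ### Trees, ordinal ranks and Bourgain's index -/

/-- A tree on `Λ`: a set of finite sequences closed under initial segments. -/
def IsTree {Λ : Type*} (T : Set (List Λ)) : Prop :=
  ∀ s t : List Λ, s <+: t → t ∈ T → s ∈ T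

/-- A pruned tree: every node has a proper extension in the tree. -/
def IsPruned {Λ : Type*} (T : Set (List Λ)) : Prop :=
  ∀ t ∈ T, ∃ a : Λ, t ++ [a] ∈ T

/-- `σ` is an infinite branch of `T`. -/
def IsBranch {Λ : Type*} (T : Set (List Λ)) (σ : ℕ → Λ) : Prop :=
  ∀ n : ℕ, (List.ofFn fun i : Fin n => σ i) ∈ T

/-- `T` is ill-founded: it has an infinite branch. -/
def TreeIllFounded {Λ : Type*} (T : Set (List Λ)) : Prop :=
  ∃ σ : ℕ → Λ, IsBranch T σ

/-- The derivative of a tree: its non-maximal nodes, i.e. nodes having a proper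
extension in the tree. -/
def treeDeriv {Λ : Type*} (T : Set (List Λ)) : Set (List Λ) :=
  {l | l ∈ T ∧ ∃ a : Λ, l ++ [a] ∈ T}

/-- The iterated derivatives `T^(ξ)` of a tree, defined by transfinite recursion. -/
def treeDerivIter {Λ : Type*} (T : Set (List Λ)) (ξ : Ordinal.{0}) : Set (List Λ) :=
  Ordinal.limitRecOn ξ T (fun _ S => treeDeriv S)
    (fun o _ ih => ⋂ (o' : Ordinal.{0}) (h : o' < o), ih o' h)

/-- The ordinal rank `o(T)` of a (well-founded) tree: the least `ξ` with `T^(ξ) = ∅`. -/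
def treeRank {Λ : Type*} (T : Set (List Λ)) : Ordinal.{0} :=
  sInf {ξ : Ordinal.{0} | treeDerivIter T ξ = ∅}

/-- The first uncountable ordinal `ω₁`. -/
def omega1 : Ordinal.{0} := (Cardinal.aleph 1).ord

/-- Bourgain's tree `T(Y, (e_n), δ)`: all finite sequences `(y_0, …, y_k)` in `Y`
which are `δ`-equivalent to `(e_0, …, e_k)`. -/
def bourgainTree {W : Type*} [SeminormedAddCommGroup W] [NormedSpace ℝ W] (e : ℕ → W)
    (δ : ℝ) (Y : Type*) [SeminormedAddCommGroup Y] [NormedSpace ℝ Y] : Set (List Y) :=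
  {l : List Y | ∀ a : ℕ → ℝ,
    δ * ‖∑ i ∈ Finset.range l.length, a i • e i‖ ≤
        ‖∑ i ∈ Finset.range l.length, a i • l.getD i 0‖ ∧
    ‖∑ i ∈ Finset.range l.length, a i • l.getD i 0‖ ≤
        δ⁻¹ * ‖∑ i ∈ Finset.range l.length, a i • e i‖}

open Classical in
/-- Bourgain's ordinal index of `Y` relative to a (normalized Schauder) basis `(e_n)`
of a space `W`: it equals `ω₁` if some tree `T(Y, (e_n), δ)` is ill-founded, and
otherwise `sup_{0 < δ ≤ 1} o(T(Y, (e_n), δ))`.  With `W = C(2^ℕ)` this is `φ_NU`,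
and with `W = Z` it is `φ_{NC_Z}`. -/
def bourgainIndex {W : Type*} [SeminormedAddCommGroup W] [NormedSpace ℝ W] (e : ℕ → W)
    (Y : Type*) [SeminormedAddCommGroup Y] [NormedSpace ℝ Y] : Ordinal.{0} :=
  if ∃ δ ∈ Set.Ioc (0:ℝ) 1, TreeIllFounded (bourgainTree e δ Y) then omega1
  else ⨆ δ : Set.Ioc (0:ℝ) 1, treeRank (bourgainTree e δ.1 Y)

/-! ### The Schur property and the Radon-Nikodym property -/

/-- `X` has the Schur property: weakly convergent sequences are norm convergent. -/
def HasSchurProperty (X : Type*) [SeminormedAddCommGroup X] [NormedSpace ℝ X] : Prop :=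
  ∀ (f : ℕ → X) (x : X),
    (∀ φ : X →L[ℝ] ℝ, Tendsto (fun n => φ (f n)) atTop (𝓝 (φ x))) →
    Tendsto f atTop (𝓝 x)

/-- `X` has the Radon-Nikodym property: on every finite measure space, every
`X`-valued vector measure of bounded variation which is absolutely continuous
with respect to the measure has a Bochner-integrable density. -/
def HasRNP (X : Type*) [NormedAddCommGroup X] [NormedSpace ℝ X] : Prop :=
  ∀ (Ω : Type) [MeasurableSpace Ω] (μ : Measure Ω), IsFiniteMeasure μ →
    ∀ τ : VectorMeasure Ω X,
      (∀ s : Set Ω, MeasurableSet s → μ s = 0 → τ s = 0) →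
      (∃ C : ℝ, ∀ P : Finset (Set Ω), (∀ s ∈ P, MeasurableSet s) →
        ((P : Set (Set Ω)).Pairwise fun s t => Disjoint s t) →
        ∑ s ∈ P, ‖τ s‖ ≤ C) →
      ∃ g : Ω → X, Integrable g μ ∧
        ∀ s : Set Ω, MeasurableSet s → τ s = ∫ x in s, g x ∂μ

/-! ### `𝓛_{∞,λ}`-spaces -/

/-- The Banach-Mazur distance from `G` to `ℓ∞^n` is at most `θ`, witnessed by an
isomorphism `e` with `‖e‖ ⬝ ‖e⁻¹‖ ≤ θ'` for every `θ' > θ`. -/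
def BMdistToLinftyLE (G : Type*) [SeminormedAddCommGroup G] [NormedSpace ℝ G]
    (n : ℕ) (θ : ℝ) : Prop :=
  ∀ θ' : ℝ, θ < θ' → ∃ e : G ≃L[ℝ] (Fin n → ℝ),
    ‖(e : G →L[ℝ] (Fin n → ℝ))‖ * ‖(e.symm : (Fin n → ℝ) →L[ℝ] G)‖ ≤ θ'

/-- `X` is an (infinite-dimensional) `𝓛_{∞,λ}`-space: every finite-dimensional subspace
`F` of `X` is contained in a finite-dimensional subspace `G` with `d(G, ℓ∞^(dim G)) ≤ λ`. -/
def IsLinftyLam (lam : ℝ) (X : Type*) [NormedAddCommGroup X] [NormedSpace ℝ X] : Prop :=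
  (¬ FiniteDimensional ℝ X) ∧
  ∀ F : Submodule ℝ X, FiniteDimensional ℝ F →
    ∃ G : Submodule ℝ X, F ≤ G ∧ FiniteDimensional ℝ G ∧
      BMdistToLinftyLE G (Module.finrank ℝ G) lam

/-- `X` is an `𝓛_{∞,λ+}`-space: it is an `𝓛_{∞,θ}`-space for every `θ > λ`. -/
def IsLinftyPlus (lam : ℝ) (X : Type*) [NormedAddCommGroup X] [NormedSpace ℝ X] : Prop :=
  ∀ θ : ℝ, lam < θ → IsLinftyLam θ X

/-! ### Minimal spaces and `ℓ₁` -/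

/-- The space `ℓ₁`. -/
abbrev EllOne : Type := lp (fun _ : ℕ => ℝ) 1

/-- `X` is a minimal Banach space: it is infinite-dimensional and embeds isomorphically
into every infinite-dimensional (closed) subspace of itself. -/
def IsMinimal (X : Type*) [NormedAddCommGroup X] [NormedSpace ℝ X] : Prop :=
  (¬ FiniteDimensional ℝ X) ∧
  ∀ Z : Submodule ℝ X, IsClosed (Z : Set X) → ¬ FiniteDimensional ℝ Z → Embeds X Z

end



/-- diagonalization over almost-decreasing infinite sets -/
lemma aux_diag (P : ℕ → Set ℕ → Prop)
    (hstab : ∀ k N N', P k N → N'.Infinite → (N' \ N).Finite → P k N')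
    (M : Set ℕ) (hM : M.Infinite)
    (hex : ∀ k M', M' ⊆ M → M'.Infinite → ∃ N ⊆ M', N.Infinite ∧ P k N) :
    ∃ N ⊆ M, N.Infinite ∧ ∀ k, P k N := by
  choose! F hF1 hF2 hF3 using hex
  let W : ℕ → Set ℕ := fun n => Nat.rec M (fun k S => F k S) n
  have hW0 : W 0 = M := rfl
  have hWs : ∀ n, W (n+1) = F n (W n) := fun n => rfl
  have hW : ∀ n, W n ⊆ M ∧ (W n).Infinite := by
    intro n
    induction n with
    | zero => exact ⟨subset_rfl, hM⟩
    | succ n ih =>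
      rw [hWs]
      exact ⟨(hF1 n _ ih.1 ih.2).trans ih.1, hF2 n _ ih.1 ih.2⟩
  have hanti : Antitone W := antitone_nat_of_succ_le fun n => by
    rw [hWs]; exact hF1 n _ (hW n).1 (hW n).2
  have hpick : ∀ n m, ∃ x ∈ W n, m < x := fun n m => (hW n).2.exists_gt m
  choose p hp1 hp2 using hpick
  let q : ℕ → ℕ := fun n => Nat.rec (p 0 0) (fun k x => p (k+1) x) n
  have hqs : ∀ n, q (n+1) = p (n+1) (q n) := fun n => rfl
  have hqW : ∀ n, q n ∈ W n := by
    intro n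
    cases n with
    | zero => exact hp1 0 0
    | succ n => exact hp1 (n+1) (q n)
  have hqm : StrictMono q := strictMono_nat_of_lt_succ fun n => by rw [hqs]; exact hp2 _ _
  refine ⟨Set.range q, ?_, Set.infinite_range_of_injective hqm.injective, ?_⟩
  · rintro _ ⟨n, rfl⟩
    exact (hW n).1 (hqW n)
  · intro k
    refine hstab k (W (k+1)) _ ?_ (Set.infinite_range_of_injective hqm.injective) ?_
    · rw [hWs]; exact hF3 k _ (hW k).1 (hW k).2
    · refine ((Set.finite_lt_nat (k+1)).image q).subset ?_
      rintro _ ⟨⟨n, rfl⟩, hn⟩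
      refine ⟨n, ?_, rfl⟩
      by_contra h
      exact hn (hanti (not_lt.mp h) (hqW n))

/-- no subsequence of `M` converges on `C` -/
def AuxBad {K : Type*} (A : Bool → ℕ → Set K) (M : Set ℕ) (C : Set K) : Prop :=
  ∀ N ⊆ M, N.Infinite → ∃ x ∈ C, ∀ b, {n ∈ N | x ∈ A b n}.Infinite

lemma aux_step {K : Type*} (A : Bool → ℕ → Set K) (M : Set ℕ) (hM : M.Infinite)
    (𝒞 : Set (Set K)) (hfin : 𝒞.Finite) (hbad : ∀ C ∈ 𝒞, AuxBad A M C) :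
    ∃ j, ∃ M' ⊆ M, M'.Infinite ∧ ∀ C ∈ 𝒞, ∀ b, AuxBad A M' (C ∩ A b j) := by
  by_contra hcon
  push Not at hcon
  let P : ℕ → Set ℕ → Prop := fun j N => ∃ C ∈ 𝒞, ∃ b, ∀ x ∈ C ∩ A b j,
    ∃ b', {n ∈ N | x ∈ A b' n}.Finite
  obtain ⟨N, hNM, hN, hP⟩ := aux_diag P (by
    rintro k N N' ⟨C, hC, b, h⟩ _ hd
    refine ⟨C, hC, b, fun x hx => ?_⟩
    obtain ⟨b', hb'⟩ := h x hx
    refine ⟨b', (hb'.union hd).subset ?_⟩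
    rintro n ⟨hn, hn'⟩
    by_cases h : n ∈ N
    · exact Or.inl ⟨h, hn'⟩
    · exact Or.inr ⟨hn, h⟩) M hM (by
    intro k M' hM' hM'i
    obtain ⟨C, hC, b, hb⟩ := hcon k M' hM' hM'i
    unfold AuxBad at hb
    push Not at hb
    obtain ⟨N, hN1, hN2, hN3⟩ := hb
    exact ⟨N, hN1, hN2, C, hC, b, fun x hx => by simpa using hN3 x hx⟩)
  choose c hc b hb using hP
  have hpig : ∃ y ∈ 𝒞 ×ˢ (Set.univ : Set Bool), {n ∈ N | (c n, b n) = y}.Infinite := by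
    by_contra h
    push Not at h
    refine hN (((hfin.prod Set.finite_univ).biUnion (fun y hy => ?_)).subset
      (s := ⋃ y ∈ 𝒞 ×ˢ (Set.univ : Set Bool), {n ∈ N | (c n, b n) = y}) ?_)
    · exact Set.not_infinite.mp (fun hh => absurd (h y hy) (by simpa using hh))
    · intro n hn
      simp only [Set.mem_iUnion]
      exact ⟨(c n, b n), ⟨hc n, trivial⟩, hn, rfl⟩
  obtain ⟨⟨C, s⟩, ⟨hC, -⟩, hinf⟩ := hpig
  obtain ⟨x, hx, hxb⟩ := hbad C hC _ ((Set.sep_subset _ _).trans hNM) hinf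
  obtain ⟨j, ⟨hj, hje⟩, hjx⟩ := (hxb s).nonempty
  simp only [Prod.mk.injEq] at hje
  obtain ⟨b', hb'⟩ := hb j x (by rw [hje.1, hje.2]; exact ⟨hx, hjx⟩)
  exact hxb b' (hb'.subset fun n hn => ⟨hn.1.1, hn.2⟩)

lemma aux_indep {K : Type*} (A : Bool → ℕ → Set K) (M : Set ℕ) (hM : M.Infinite)
    (hbad : AuxBad A M Set.univ) :
    ∃ j : ℕ → ℕ, ∀ (σ : ℕ → Bool) (k : ℕ), ∃ x, ∀ i < k, x ∈ A (σ i) (j i) := by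
  let S := {p : Set (Set K) × Set ℕ // p.1.Finite ∧ p.2.Infinite ∧ ∀ C ∈ p.1, AuxBad A p.2 C}
  have hstep : ∀ p : S, ∃ j : ℕ, ∃ p' : S, ∀ C ∈ p.1.1, ∀ b, C ∩ A b j ∈ p'.1.1 := by
    rintro ⟨⟨𝒞, M⟩, hf, hi, hb⟩
    obtain ⟨j, M', -, hM'i, h⟩ := aux_step A M hi 𝒞 hf hb
    refine ⟨j, ⟨((fun y : Set K × Bool => y.1 ∩ A y.2 j) '' (𝒞 ×ˢ Set.univ), M'),
      (hf.prod Set.finite_univ).image _, hM'i, ?_⟩, ?_⟩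
    · rintro _ ⟨⟨C, b⟩, ⟨hC, -⟩, rfl⟩
      exact h C hC b
    · intro C hC b
      exact ⟨(C, b), ⟨hC, trivial⟩, rfl⟩
  choose j nx hnx using hstep
  let p0 : S := ⟨({Set.univ}, M), Set.finite_singleton _, hM, by
    rintro C rfl; exact hbad⟩
  let Q : ℕ → S := fun n => Nat.rec p0 (fun _ p => nx p) n
  refine ⟨fun n => j (Q n), fun σ k => ?_⟩
  have key : ∀ k, {x | ∀ i < k, x ∈ A (σ i) (j (Q i))} ∈ (Q k).1.1 := by
    intro k
    induction k with
    | zero => simp [Q, p0]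
    | succ k ih =>
      have := hnx (Q k) _ ih (σ k)
      convert this using 1
      ext x
      simp only [Set.mem_setOf_eq, Set.mem_inter_iff, Nat.lt_succ_iff_lt_or_eq]
      constructor
      · intro h
        exact ⟨fun i hi => h i (Or.inl hi), h k (Or.inr rfl)⟩
      · rintro ⟨h1, h2⟩ i (hi | rfl)
        · exact h1 i hi
        · exact h2
  obtain ⟨x, hx, -⟩ := (Q k).2.2.2 _ (key k) _ subset_rfl (Q k).2.2.1
  exact ⟨x, hx⟩

lemma aux_ellOne {E : Type*} [NormedAddCommGroup E] [NormedSpace ℝ E] [CompleteSpace E]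
    (y : ℕ → E) (R : ℝ) (hR : ∀ n, ‖y n‖ ≤ R) (δ : ℝ) (hδ : 0 < δ)
    (hlow : ∀ (a : ℕ → ℝ) (k : ℕ), δ * ∑ i ∈ Finset.range k, |a i| ≤
      ‖∑ i ∈ Finset.range k, a i • y i‖) : Embeds EllOne E := by
  have hsum : ∀ a : EllOne, HasSum (fun i => |a i|) ‖a‖ := by
    intro a
    have := lp.hasSum_norm (p := 1) (by simp) a
    simpa using this
  have hR0 : 0 ≤ R := (norm_nonneg _).trans (hR 0)
  have hs : ∀ a : EllOne, Summable (fun i => ‖a i • y i‖) := by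
    intro a
    refine Summable.of_nonneg_of_le (fun i => norm_nonneg _) (fun i => ?_)
      ((hsum a).summable.mul_right R)
    rw [norm_smul, Real.norm_eq_abs]
    exact mul_le_mul_of_nonneg_left (hR i) (abs_nonneg _)
  let T : EllOne →ₗ[ℝ] E :=
    { toFun := fun a => ∑' i, a i • y i
      map_add' := fun a b => by
        rw [← (hs a).of_norm.tsum_add (hs b).of_norm]
        refine tsum_congr fun i => ?_
        rw [← add_smul]; rfl
      map_smul' := fun c a => by
        rw [RingHom.id_apply, ← (hs a).of_norm.tsum_const_smul]
        refine tsum_congr fun i => ?_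
        rw [smul_smul]; rfl }
  refine ⟨T.mkContinuous R ?_, δ, hδ, ?_⟩
  · intro a
    refine (norm_tsum_le_tsum_norm (hs a)).trans ?_
    rw [mul_comm, ← (hsum a).tsum_eq, ← tsum_mul_right]
    refine Summable.tsum_le_tsum (fun i => ?_) (hs a) ((hsum a).summable.mul_right R)
    rw [norm_smul, Real.norm_eq_abs]
    exact mul_le_mul_of_nonneg_left (hR i) (abs_nonneg _)
  · intro a
    have h1 : Tendsto (fun k => δ * ∑ i ∈ Finset.range k, |a i|) atTop (𝓝 (δ * ‖a‖)) :=
      (hsum a).tendsto_sum_nat.const_mul δ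
    have h2 : Tendsto (fun k => ‖∑ i ∈ Finset.range k, a i • y i‖) atTop
        (𝓝 ‖∑' i, a i • y i‖) :=
      (hs a).of_norm.hasSum.tendsto_sum_nat.norm
    exact le_of_tendsto_of_tendsto' h1 h2 (fun k => hlow a k)

/-- Rosenthal's `ℓ₁` theorem. -/
lemma aux_rosenthal {E : Type*} [NormedAddCommGroup E] [NormedSpace ℝ E] [CompleteSpace E]
    (h1 : ¬ Embeds EllOne E) (x : ℕ → E) (R : ℝ) (hR : ∀ n, ‖x n‖ ≤ R) :
    ∃ u : ℕ → ℕ, StrictMono u ∧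
      ∀ φ : E →L[ℝ] ℝ, ∃ c, Tendsto (fun n => φ (x (u n))) atTop (𝓝 c) := by
  let K := {φ : E →L[ℝ] ℝ // ‖φ‖ ≤ 1}
  let A : ℝ → ℝ → Bool → ℕ → Set K := fun r s b n =>
    {φ | if b then s < φ.1 (x n) else φ.1 (x n) < r}
  by_cases hcase : ∃ r s : ℝ, r < s ∧ ∃ M : Set ℕ, M.Infinite ∧ AuxBad (A r s) M Set.univ
  · exfalso
    obtain ⟨r, s, hrs, M, hM, hbad⟩ := hcase
    obtain ⟨j, hj⟩ := aux_indep _ M hM hbad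
    refine h1 (aux_ellOne (fun n => x (j n)) R (fun n => hR _) ((s - r) / 2) (by linarith) ?_)
    intro a k
    obtain ⟨φ, hφ⟩ := hj (fun i => decide (0 ≤ a i)) k
    obtain ⟨ψ, hψ⟩ := hj (fun i => decide (a i < 0)) k
    have hb : (φ.1 - ψ.1) (∑ i ∈ Finset.range k, a i • x (j i)) ≤
        2 * ‖∑ i ∈ Finset.range k, a i • x (j i)‖ := by
      refine (le_abs_self _).trans (((φ.1 - ψ.1).le_opNorm _).trans ?_)
      refine mul_le_mul_of_nonneg_right ?_ (norm_nonneg _)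
      refine (norm_sub_le _ _).trans ?_
      have := φ.2
      have := ψ.2
      linarith
    have hl : (s - r) * ∑ i ∈ Finset.range k, |a i| ≤
        (φ.1 - ψ.1) (∑ i ∈ Finset.range k, a i • x (j i)) := by
      rw [map_sum, Finset.mul_sum]
      refine Finset.sum_le_sum fun i hi => ?_
      have e1 := hφ i (Finset.mem_range.mp hi)
      have e2 := hψ i (Finset.mem_range.mp hi)
      rw [map_smul, smul_eq_mul, ContinuousLinearMap.sub_apply]
      by_cases ha : 0 ≤ a i
      · have ha' : ¬ a i < 0 := not_lt.mpr ha
        simp only [A, ha, ha', decide_true, decide_false, Set.mem_setOf_eq, if_true,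
          Bool.false_eq_true, if_false] at e1 e2
        rw [abs_of_nonneg ha]
        nlinarith
      · have ha' : a i < 0 := not_le.mp ha
        simp only [A, ha, ha', decide_true, decide_false, Set.mem_setOf_eq, if_true,
          Bool.false_eq_true, if_false] at e1 e2
        rw [abs_of_neg ha']
        nlinarith
    linarith
  · push Not at hcase
    obtain ⟨p, hp⟩ := exists_surjective_nat (ℚ × ℚ)
    let P : ℕ → Set ℕ → Prop := fun k N => ((p k).1 : ℝ) < (p k).2 →
      ∀ φ : K, ∃ b, {n ∈ N | φ ∈ A (p k).1 (p k).2 b n}.Finite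
    obtain ⟨N, -, hN, hP⟩ := aux_diag P (by
      intro k N N' h _ hd hlt φ
      obtain ⟨b', hb'⟩ := h hlt φ
      refine ⟨b', (hb'.union hd).subset ?_⟩
      rintro n ⟨hn, hn'⟩
      by_cases h : n ∈ N
      · exact Or.inl ⟨h, hn'⟩
      · exact Or.inr ⟨hn, h⟩) Set.univ Set.infinite_univ (by
      intro k M' _ hM'i
      by_cases hlt : ((p k).1 : ℝ) < (p k).2
      · have hb := hcase _ _ hlt M' hM'i
        unfold AuxBad at hb
        push Not at hb
        obtain ⟨N, hN1, hN2, hN3⟩ := hb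
        exact ⟨N, hN1, hN2, fun _ φ => by simpa using hN3 φ trivial⟩
      · exact ⟨M', subset_rfl, hM'i, fun h => absurd h hlt⟩)
    let u : ℕ → ℕ := Nat.nth (· ∈ N)
    have hu : StrictMono u := Nat.nth_strictMono hN
    have huN : ∀ n, u n ∈ N := Nat.nth_mem_of_infinite hN
    refine ⟨u, hu, ?_⟩
    have hK : ∀ φ : K, ∃ c, Tendsto (fun n => φ.1 (x (u n))) atTop (𝓝 c) := by
      intro φ
      have hbd : ∀ n, |φ.1 (x (u n))| ≤ R := fun n => by
        refine (φ.1.le_opNorm _).trans ?_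
        have := φ.2
        have := hR (u n)
        have := norm_nonneg (x (u n))
        nlinarith
      refine tendsto_of_no_upcrossings (s := Set.range ((↑) : ℚ → ℝ)) Rat.denseRange_cast ?_ ?_ ?_
      · rintro _ ⟨a, rfl⟩ _ ⟨b, rfl⟩ hab ⟨f1, f2⟩
        obtain ⟨k, hk⟩ := hp (a, b)
        have := hP k
        simp only [P, hk] at this
        obtain ⟨c, hc⟩ := this hab φ
        rw [Nat.frequently_atTop_iff_infinite] at f1 f2
        cases c
        · refine (f1.image hu.injective.injOn) (hc.subset ?_)
          rintro _ ⟨n, hn, rfl⟩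
          exact ⟨huN n, by simpa [A] using hn⟩
        · refine (f2.image hu.injective.injOn) (hc.subset ?_)
          rintro _ ⟨n, hn, rfl⟩
          exact ⟨huN n, by simpa [A] using hn⟩
      · exact isBoundedUnder_of ⟨R, fun n => (abs_le.mp (hbd n)).2⟩
      · exact isBoundedUnder_of ⟨-R, fun n => (abs_le.mp (hbd n)).1⟩
    intro φ
    have hpos : 0 < ‖φ‖ + 1 := by positivity
    obtain ⟨c, hc⟩ := hK ⟨(‖φ‖ + 1)⁻¹ • φ, by
      rw [norm_smul, norm_inv, Real.norm_of_nonneg hpos.le, inv_mul_le_iff₀ hpos]; linarith⟩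
    refine ⟨(‖φ‖ + 1) * c, (hc.const_mul (‖φ‖ + 1)).congr fun n => ?_⟩
    simp only [ContinuousLinearMap.smul_apply, smul_eq_mul]
    field_simp

/-- `R` into a Schur space is not bounded below on finite-codimensional subspaces. -/
lemma aux_small {E : Type*} [NormedAddCommGroup E] [NormedSpace ℝ E] [CompleteSpace E]
    (h1 : ¬ Embeds EllOne E) {W : Type*} [SeminormedAddCommGroup W] [NormedSpace ℝ W]
    (hW : HasSchurProperty W) (R : E →L[ℝ] W) (Z : Submodule ℝ E)
    (hZ : ¬ FiniteDimensional ℝ Z) (ε : ℝ) (hε : 0 < ε) :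
    ∃ z ∈ Z, ‖z‖ = 1 ∧ ‖R z‖ < ε := by
  obtain ⟨C, f, -, hf, hsep⟩ := exists_seq_norm_le_one_le_norm_sub (𝕜 := ℝ) (E := Z) hZ
  obtain ⟨u, hu, hφ⟩ := aux_rosenthal h1 (fun n => (f n : E)) C hf
  let w : ℕ → E := fun n => (f (u (n+1)) : E) - f (u n)
  have hw1 : ∀ n, 1 ≤ ‖w n‖ := fun n => hsep (hu (Nat.lt_succ_self n)).ne'
  have hw0 : Tendsto (fun n => R (w n)) atTop (𝓝 0) := by
    refine hW _ 0 fun ψ => ?_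
    obtain ⟨c, hc⟩ := hφ (ψ.comp R)
    have := (hc.comp (tendsto_add_atTop_nat 1)).sub hc
    simpa [w] using this
  have := hw0.norm
  rw [norm_zero] at this
  obtain ⟨n, hn⟩ := (this.eventually_lt_const hε).exists
  have hpos : 0 < ‖w n‖ := lt_of_lt_of_le one_pos (hw1 n)
  refine ⟨‖w n‖⁻¹ • w n, Z.smul_mem _ (Z.sub_mem (f _).2 (f _).2), ?_, ?_⟩
  · rw [norm_smul, norm_inv, norm_norm, inv_mul_cancel₀ hpos.ne']
  · rw [map_smul, norm_smul, norm_inv, norm_norm]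
    refine lt_of_le_of_lt ?_ hn
    rw [inv_mul_le_iff₀ hpos]
    nlinarith [norm_nonneg (R (w n)), hw1 n]

/-- biorthogonalization of a triangular system -/
noncomputable def auxG {E : Type*} [NormedAddCommGroup E] [NormedSpace ℝ E]
    (z : ℕ → E) (f : ℕ → E →L[ℝ] ℝ) (n : ℕ) : E →L[ℝ] ℝ :=
  f n - ∑ k : Fin n, f n (z k) • auxG z f k
termination_by n
decreasing_by exact k.2

lemma auxG_eq {E : Type*} [NormedAddCommGroup E] [NormedSpace ℝ E]
    (z : ℕ → E) (f : ℕ → E →L[ℝ] ℝ) (n : ℕ) :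
    auxG z f n = f n - ∑ k ∈ Finset.range n, f n (z k) • auxG z f k := by
  rw [auxG, Finset.sum_range]

lemma auxG_norm {E : Type*} [NormedAddCommGroup E] [NormedSpace ℝ E]
    (z : ℕ → E) (f : ℕ → E →L[ℝ] ℝ) (hz : ∀ n, ‖z n‖ = 1) (hf : ∀ n, ‖f n‖ ≤ 1) (n : ℕ) :
    ‖auxG z f n‖ ≤ 2 ^ n := by
  induction n using Nat.strong_induction_on with
  | _ n ih =>
    rw [auxG_eq]
    have h2 : ‖∑ k ∈ Finset.range n, f n (z k) • auxG z f k‖ ≤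
        ∑ k ∈ Finset.range n, (2 : ℝ) ^ k := by
      refine norm_sum_le_of_le _ fun k hk => ?_
      rw [norm_smul]
      have h3 : ‖f n (z k)‖ ≤ 1 := by
        refine ((f n).le_opNorm _).trans ?_
        rw [hz, mul_one]; exact hf n
      calc ‖f n (z k)‖ * ‖auxG z f k‖ ≤ 1 * 2 ^ k :=
            mul_le_mul h3 (ih k (Finset.mem_range.mp hk)) (norm_nonneg _) zero_le_one
        _ = 2 ^ k := one_mul _
    have h4 : ∑ k ∈ Finset.range n, (2 : ℝ) ^ k = 2 ^ n - 1 := by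
      rw [geom_sum_eq (by norm_num)]; norm_num
    have := norm_sub_le (f n) (∑ k ∈ Finset.range n, f n (z k) • auxG z f k)
    linarith [hf n]

lemma auxG_apply {E : Type*} [NormedAddCommGroup E] [NormedSpace ℝ E]
    (z : ℕ → E) (f : ℕ → E →L[ℝ] ℝ) (h1 : ∀ n, f n (z n) = 1)
    (h0 : ∀ k n, k < n → f k (z n) = 0) (n m : ℕ) :
    auxG z f n (z m) = if m = n then 1 else 0 := by
  induction n using Nat.strong_induction_on with
  | _ n ih =>
    rw [auxG_eq]
    have h2 : (f n - ∑ k ∈ Finset.range n, f n (z k) • auxG z f k) (z m) =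
        f n (z m) - ∑ k ∈ Finset.range n, f n (z k) * (if m = k then 1 else 0) := by
      simp only [sub_apply, ContinuousLinearMap.sum_apply, smul_apply, smul_eq_mul]
      congr 1
      refine Finset.sum_congr rfl fun k hk => ?_
      rw [ih k (Finset.mem_range.mp hk)]
    rw [h2]
    simp only [mul_ite, mul_one, mul_zero, Finset.sum_ite_eq, Finset.mem_range]
    rcases lt_trichotomy m n with h | h | h
    · simp [h, h.ne]
    · simp [h, h1]
    · simp [h.ne', h.not_gt, h0 n m h]

lemma aux_seq {E : Type*} [NormedAddCommGroup E] [NormedSpace ℝ E] [CompleteSpace E]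
    (hE : ¬ FiniteDimensional ℝ E)
    (h1 : ¬ Embeds EllOne E) {W : Type*} [SeminormedAddCommGroup W] [NormedSpace ℝ W]
    (hW : HasSchurProperty W) (R : E →L[ℝ] W) (δ : ℝ) (hδ : 0 < δ) :
    ∃ (z : ℕ → E) (g : ℕ → E →L[ℝ] ℝ), (∀ n, ‖g n‖ ≤ 2 ^ n) ∧
      (∀ n m, g n (z m) = if m = n then 1 else 0) ∧ ∀ n, ‖R (z n)‖ < δ * (1/4) ^ n := by
  obtain ⟨F, hF1, hF2⟩ := exists_seq_of_forall_finset_exists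
    (fun t : E × (E →L[ℝ] ℝ) × ℕ => ‖t.1‖ = 1 ∧ ‖t.2.1‖ ≤ 1 ∧ t.2.1 t.1 = 1 ∧
      ‖R t.1‖ < δ * (1/4) ^ t.2.2)
    (fun s t => s.2.1 t.1 = 0 ∧ s.2.2 < t.2.2) (by
      intro s _
      let L : E →ₗ[ℝ] (s → ℝ) := LinearMap.pi fun i => (i.1.2.1 : E →ₗ[ℝ] ℝ)
      have hker : ¬ FiniteDimensional ℝ (LinearMap.ker L) := by
        intro hk
        apply hE
        refine ⟨Submodule.fg_of_fg_map_of_fg_inf_ker L ?_ ?_⟩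
        · exact IsNoetherian.noetherian _
        · rw [top_inf_eq]
          exact Module.Finite.iff_fg.mp hk
      let k := s.sup (fun t => t.2.2) + 1
      obtain ⟨z, hz, hz1, hzR⟩ := aux_small h1 hW R _ hker (δ * (1/4) ^ k) (by positivity)
      obtain ⟨φ, hφ, hφz⟩ := exists_dual_vector'' ℝ z
      refine ⟨(z, φ, k), ⟨hz1, hφ, by simpa [hz1] using hφz, hzR⟩, fun t ht => ⟨?_, ?_⟩⟩
      · exact congrFun (LinearMap.mem_ker.mp hz) ⟨t, ht⟩
      · exact Nat.lt_succ_of_le (Finset.le_sup (f := fun t : E × (E →L[ℝ] ℝ) × ℕ => t.2.2) ht))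
  have hmono : StrictMono fun n => (F n).2.2 := fun m n h => (hF2 m n h).2
  refine ⟨fun n => (F n).1, auxG (fun n => (F n).1) (fun n => (F n).2.1),
    auxG_norm _ _ (fun n => (hF1 n).1) (fun n => (hF1 n).2.1),
    auxG_apply _ _ (fun n => (hF1 n).2.2.1) (fun m n h => (hF2 m n h).1), fun n => ?_⟩
  refine (hF1 n).2.2.2.trans_le (mul_le_mul_of_nonneg_left ?_ hδ.le)
  exact pow_le_pow_of_le_one (by norm_num) (by norm_num) (hmono.le_apply)

/-- **Proposition.** Let `E` be a minimal Banach space not containing `ℓ₁`, and let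
`Y` be a closed subspace of a Banach space `X` such that `X/Y` has the Schur property.
If `Y` contains no isomorphic copy of `E`, then neither does `X`. -/
theorem no_copy_of_minimal_of_schur_quotient (E : Type*) [NormedAddCommGroup E]
    [NormedSpace ℝ E] [CompleteSpace E]
    (hmin : IsMinimal E) (hEl1 : ¬ Embeds EllOne E)
    (X : Type*) [NormedAddCommGroup X] [NormedSpace ℝ X] [CompleteSpace X]
    (Y : Submodule ℝ X) (hY : IsClosed (Y : Set X))
    (hSchur : HasSchurProperty (X ⧸ Y)) (hYE : ¬ Embeds E ↥Y) :
    ¬ Embeds E X := by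
  rintro ⟨T, c, hc, hT⟩
  let q : X →L[ℝ] X ⧸ Y := Y.mkQL
  obtain ⟨z, g, hg, hgz, hR⟩ := aux_seq hmin.1 hEl1 hSchur (q.comp T) (c / 4) (by positivity)
  have hd : ∀ n, ∃ d : X, T (z n) - d ∈ Y ∧ ‖d‖ ≤ c / 4 * (1/4) ^ n := by
    intro n
    obtain ⟨d, hd, hdn⟩ := Submodule.Quotient.norm_mk_lt ((q.comp T) (z n)) (sub_pos.mpr (hR n))
    refine ⟨d, ?_, by linarith⟩
    exact (Submodule.Quotient.eq Y).mp hd.symm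
  choose d hdY hdn using hd
  have hle : ∀ n, ‖(g n).smulRight (d n)‖ ≤ c / 4 * (1/2) ^ n := by
    intro n
    rw [ContinuousLinearMap.norm_smulRight_apply]
    calc ‖g n‖ * ‖d n‖ ≤ 2 ^ n * (c / 4 * (1/4) ^ n) :=
          mul_le_mul (hg n) (hdn n) (norm_nonneg _) (by positivity)
      _ = c / 4 * (2 * (1/4)) ^ n := by rw [mul_pow]; ring
      _ = c / 4 * (1/2) ^ n := by norm_num
  have hgeo : HasSum (fun n : ℕ => c / 4 * (1/2 : ℝ) ^ n) (c / 4 * 2) :=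
    hasSum_geometric_two.mul_left _
  have hsum : Summable (fun n => (g n).smulRight (d n)) :=
    Summable.of_norm_bounded hgeo.summable hle
  have hD : ‖∑' n, (g n).smulRight (d n)‖ ≤ c / 4 * 2 := tsum_of_norm_bounded hgeo hle
  have hDz : ∀ m, (∑' n, (g n).smulRight (d n)) (z m) = d m := by
    intro m
    have h := hsum.hasSum.mapL (ContinuousLinearMap.apply ℝ X (z m))
    refine h.unique ?_
    have h2 := hasSum_ite_eq m (d m)
    convert h2 using 2 with n
    by_cases hnm : n = m
    · simp [hgz, hnm]
    · simp [hgz, hnm, Ne.symm hnm]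
  let S : E →L[ℝ] X := T - ∑' n, (g n).smulRight (d n)
  have hSlow : ∀ x, c / 2 * ‖x‖ ≤ ‖S x‖ := by
    intro x
    have h1 := hT x
    have h2 := (∑' n, (g n).smulRight (d n)).le_opNorm x
    have h3 := mul_le_mul_of_nonneg_right hD (norm_nonneg x)
    have h4 : ‖T x‖ - ‖(∑' n, (g n).smulRight (d n)) x‖ ≤ ‖S x‖ := norm_sub_norm_le _ _
    nlinarith
  let Z : Submodule ℝ E := Y.comap (S : E →ₗ[ℝ] X)
  have hzZ : ∀ n, z n ∈ Z := fun n => by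
    change T (z n) - (∑' n, (g n).smulRight (d n)) (z n) ∈ Y
    rw [hDz]; exact hdY n
  have hZc : IsClosed (Z : Set E) := hY.preimage S.continuous
  have hlin : LinearIndependent ℝ (fun n => (⟨z n, hzZ n⟩ : Z)) := by
    rw [linearIndependent_iff']
    intro s a hs i hi
    have h := congrArg (fun v : Z => g i (v : E)) hs
    simpa [hgz, hi] using h
  have hZi : ¬ FiniteDimensional ℝ Z := by
    intro hfd
    have := hlin.finite
    exact not_finite ℕ
  obtain ⟨U, b, hb, hU⟩ := hmin.2 Z hZc hZi
  refine hYE ⟨((S.comp Z.subtypeL).codRestrict Y (fun v => v.2)).comp U, c / 2 * b,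
    by positivity, fun x => ?_⟩
  calc c / 2 * b * ‖x‖ = c / 2 * (b * ‖x‖) := by ring
    _ ≤ c / 2 * ‖U x‖ := mul_le_mul_of_nonneg_left (hU x) (by positivity)
    _ ≤ ‖S (U x)‖ := hSlow (U x)
    _ = _ := rfl
end

section
/- For every λ > 1 there exists an analytic subset 𝓛_λ of SB × SB with the following properties: (a) for every X ∈ SB there exists Y ∈ SB with (X,Y) ∈ 𝓛_λ; (b) whenever (X,Y) ∈ 𝓛_λ, there is an isometric linear embedding j : X → Y such that Y is a separable 𝓛_{∞,λ+}-space and the quotient Y/j(X) has the Schur property and the Radon–Nikodym property. -/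
open Filter Topology MeasureTheory

/-! ### Distance to a subspace -/

/-- Distance from a vector to a linear subspace. -/
noncomputable def dS {Q : Type*} [SeminormedAddCommGroup Q] [NormedSpace ℝ Q]
    (E : Submodule ℝ Q) (z : Q) : ℝ := ‖(Submodule.Quotient.mk z : Q ⧸ E)‖

section dS
variable {Q : Type*} [SeminormedAddCommGroup Q] [NormedSpace ℝ Q] (E : Submodule ℝ Q)

lemma dS_nonneg (z : Q) : 0 ≤ dS E z := norm_nonneg _

lemma dS_add (z w : Q) : dS E (z + w) ≤ dS E z + dS E w := by
  unfold dS; rw [Submodule.Quotient.mk_add]; exact norm_add_le _ _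

lemma dS_smul (c : ℝ) (z : Q) : dS E (c • z) = |c| * dS E z := by
  unfold dS; rw [Submodule.Quotient.mk_smul, norm_smul, Real.norm_eq_abs]

lemma dS_neg (z : Q) : dS E (-z) = dS E z := by
  unfold dS; rw [Submodule.Quotient.mk_neg, norm_neg]

lemma dS_zero : dS E 0 = 0 := by
  unfold dS; rw [Submodule.Quotient.mk_zero, norm_zero]

lemma dS_sub (z w : Q) : dS E (z - w) ≤ dS E z + dS E w := by
  rw [sub_eq_add_neg, ← dS_neg E w]; exact dS_add E z (-w)

lemma dS_le_norm (z : Q) : dS E z ≤ ‖z‖ := Submodule.Quotient.norm_mk_le _ _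

lemma dS_mem {e : Q} (he : e ∈ E) : dS E e = 0 := by
  unfold dS; rw [(Submodule.Quotient.mk_eq_zero E).2 he, norm_zero]

lemma dS_sub_mem (z : Q) {e : Q} (he : e ∈ E) : dS E (z - e) = dS E z := by
  unfold dS
  rw [(Submodule.Quotient.eq E).2 (show z - e - z ∈ E by simpa using E.neg_mem he)]

lemma dS_add_mem (z : Q) {e : Q} (he : e ∈ E) : dS E (z + e) = dS E z := by
  have := dS_sub_mem E z (E.neg_mem he)
  rwa [sub_neg_eq_add] at this

lemma dS_le (z : Q) {e : Q} (he : e ∈ E) : dS E z ≤ ‖z - e‖ := by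
  rw [← dS_sub_mem E z he]; exact dS_le_norm E _

lemma exists_dS_lt (z : Q) {ε : ℝ} (hε : 0 < ε) : ∃ e ∈ E, ‖z - e‖ < dS E z + ε := by
  obtain ⟨m, hm, hm'⟩ := Submodule.Quotient.norm_mk_lt (S := E) (Submodule.Quotient.mk z) hε
  refine ⟨z - m, ?_, by simpa [dS] using hm'⟩
  exact (Submodule.Quotient.eq E).1 hm.symm

lemma dS_lt_iff (z : Q) (c : ℝ) : dS E z < c ↔ ∃ e ∈ E, ‖z - e‖ < c := by
  constructor
  · intro h
    obtain ⟨e, he, h'⟩ := exists_dS_lt E z (ε := c - dS E z) (by linarith)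
    exact ⟨e, he, by linarith⟩
  · rintro ⟨e, he, h⟩
    exact (dS_le E z he).trans_lt h

lemma le_dS (z : Q) (c : ℝ) (h : ∀ e ∈ E, c ≤ ‖z - e‖) : c ≤ dS E z := by
  by_contra hc
  push Not at hc
  obtain ⟨e, he, h'⟩ := (dS_lt_iff E z c).1 hc
  linarith [h e he]

lemma dS_anti {E F : Submodule ℝ Q} (h : E ≤ F) (z : Q) : dS F z ≤ dS E z :=
  le_dS _ _ _ fun _ he => dS_le F z (h he)

lemma dS_abs_sub_le (z w : Q) : |dS E z - dS E w| ≤ ‖z - w‖ := by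
  have h1 := dS_add E (z - w) w
  have h2 := dS_sub E z (z - w)
  have h3 := dS_le_norm E (z - w)
  simp only [sub_add_cancel, sub_sub_cancel] at h1 h2
  rw [abs_le]; constructor <;> linarith

lemma continuous_dS : Continuous (dS E) := by
  refine (LipschitzWith.of_dist_le_mul (K := 1) fun x y => ?_).continuous
  simpa [Real.dist_eq, dist_eq_norm] using dS_abs_sub_le E x y

lemma dS_sum_le {ι : Type*} (s : Finset ι) (z : ι → Q) :
    dS E (∑ i ∈ s, z i) ≤ ∑ i ∈ s, dS E (z i) := by
  classical
  induction s using Finset.induction_on with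
  | empty => simp [dS_zero]
  | insert a s ha ih =>
    rw [Finset.sum_insert ha, Finset.sum_insert ha]
    exact (dS_add E _ _).trans (by linarith)

end dS

/-! ### Finite norming families on finite-dimensional subspaces -/

lemma exists_norming {E : Type*} [NormedAddCommGroup E] [NormedSpace ℝ E]
    (F : Submodule ℝ E) [FiniteDimensional ℝ F] (κ : ℝ) (hκ : κ < 1) :
    ∃ (N : ℕ) (θ : E →L[ℝ] (Fin N → ℝ)), (∀ x, ‖θ x‖ ≤ ‖x‖) ∧
      ∀ f ∈ F, κ * ‖f‖ ≤ ‖θ f‖ := by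
  haveI : ProperSpace F := FiniteDimensional.proper ℝ F
  obtain ⟨t, hts, htf, hcov⟩ := (isCompact_sphere (0 : F) 1).finite_cover_balls
    (e := 1 - κ) (by linarith)
  choose g hg1 hg2 using fun x : E => exists_dual_vector'' ℝ x
  haveI := htf.fintype
  let eq := Fintype.equivFin t
  refine ⟨Fintype.card t, ContinuousLinearMap.pi fun j => g ((eq.symm j : F) : E), ?_, ?_⟩
  · intro x
    rw [pi_norm_le_iff_of_nonneg (norm_nonneg _)]
    intro j
    exact ((g _).le_of_opNorm_le (hg1 _) x).trans (by simp)
  · intro f hf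
    by_cases h0 : f = 0
    · subst h0; simp
    have hn : 0 < ‖f‖ := norm_pos_iff.2 h0
    have hu : (⟨‖f‖⁻¹ • f, F.smul_mem _ hf⟩ : F) ∈ Metric.sphere (0 : F) 1 := by
      simp [norm_smul, hn.ne']
    obtain ⟨c, hc⟩ := Set.mem_iUnion.1 (hcov hu)
    obtain ⟨hct, hc⟩ := Set.mem_iUnion.1 hc
    have hc1 : ‖(c : E)‖ = 1 := by simpa using hts hct
    have hd : ‖‖f‖⁻¹ • f - (c : E)‖ < 1 - κ := by
      simpa [dist_eq_norm, Subtype.dist_eq] using hc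
    have h1 : |g c (‖f‖⁻¹ • f - (c : E))| < 1 - κ :=
      lt_of_le_of_lt (((g (c : E)).le_of_opNorm_le (hg1 _) _).trans (by simp)) hd
    rw [map_sub, hg2, hc1, map_smul, smul_eq_mul] at h1
    have h2 : κ < ‖f‖⁻¹ * g c f := by
      have := (abs_lt.1 h1).1
      simp only [RCLike.ofReal_real_eq_id, id] at this
      linarith
    have h3 : κ * ‖f‖ ≤ g c f := by
      have := mul_lt_mul_of_pos_right h2 hn
      rw [mul_right_comm, inv_mul_cancel₀ hn.ne', one_mul] at this
      exact this.le
    refine (h3.trans (le_abs_self _)).trans ?_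
    have h4 := norm_le_pi_norm (ContinuousLinearMap.pi (fun j => g ((eq.symm j : F) : E)) f)
      (eq ⟨c, hct⟩)
    simpa using h4

/-- With a finite-dimensional subspace `E`, the norm is controlled by finitely many functionals
and the distance to `E`. -/
lemma exists_control {Q : Type*} [NormedAddCommGroup Q] [NormedSpace ℝ Q]
    (E : Submodule ℝ Q) [FiniteDimensional ℝ E] :
    ∃ (N : ℕ) (θ : Q →L[ℝ] (Fin N → ℝ)), ∀ z, ‖z‖ ≤ 2 * ‖θ z‖ + 3 * dS E z := by
  obtain ⟨N, θ, h1, h2⟩ := exists_norming E (1 / 2) (by norm_num)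
  refine ⟨N, θ, fun z => ?_⟩
  refine le_of_forall_pos_le_add fun ε hε => ?_
  obtain ⟨e, he, hz⟩ := exists_dS_lt E z (ε := ε / 3) (by positivity)
  have h3 := h2 e he
  have h4 := h1 (z - e)
  rw [map_sub] at h4
  have h5 : ‖θ e‖ ≤ ‖θ z‖ + ‖θ z - θ e‖ := by
    have := norm_sub_le (θ z) (θ z - θ e); simpa using this
  have h6 : ‖z‖ ≤ ‖e‖ + ‖z - e‖ := by
    have := norm_add_le e (z - e); simpa using this
  linarith

/-! ### The chain inequality -/

/-- The key convexity inequality for the pair `E ⊆ Q`. -/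
def ChainIneq {Q : Type*} [SeminormedAddCommGroup Q] [NormedSpace ℝ Q] (δ : ℝ)
    (E : Submodule ℝ Q) : Prop :=
  ∀ (m : ℕ) (z : Fin m → Q),
    ‖∑ i, z i‖ + δ * ∑ i, dS E (z i) ≤ ∑ i, ‖z i‖ + 2 * dS E (∑ i, z i)

lemma ChainIneq.finset {Q : Type*} [SeminormedAddCommGroup Q] [NormedSpace ℝ Q] {δ : ℝ}
    {E : Submodule ℝ Q} (h : ChainIneq δ E) {ι : Type*} (s : Finset ι) (z : ι → Q) :
    ‖∑ i ∈ s, z i‖ + δ * ∑ i ∈ s, dS E (z i) ≤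
      ∑ i ∈ s, ‖z i‖ + 2 * dS E (∑ i ∈ s, z i) := by
  have key : ∀ {M : Type _} [AddCommMonoid M] (f : ι → M),
      ∑ i : Fin s.card, f (s.equivFin.symm i) = ∑ i ∈ s, f i := by
    intro M _ f
    rw [← Finset.sum_coe_sort s f]
    exact Equiv.sum_comp s.equivFin.symm (fun i : s => f i)
  have key2 : ∀ (f : ι → ℝ),
      ∑ i : Fin s.card, f (s.equivFin.symm i) = ∑ i ∈ s, f i := by
    intro f
    rw [← Finset.sum_coe_sort s f]
    exact Equiv.sum_comp s.equivFin.symm (fun i : s => f i)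
  have := h s.card (fun i => z (s.equivFin.symm i))
  rwa [key z, key2 (fun i => dS E (z i)), key2 (fun i => ‖z i‖)] at this

/-- `Q` is the closed union of an increasing chain of finite-dimensional subspaces satisfying the
chain inequality. -/
def HasChain (Q : Type*) [SeminormedAddCommGroup Q] [NormedSpace ℝ Q] (δ : ℝ) : Prop :=
  ∃ En : ℕ → Submodule ℝ Q, (∀ n, FiniteDimensional ℝ (En n)) ∧ (∀ n, ChainIneq δ (En n)) ∧
    Monotone En ∧ ∀ (z : Q) (ε : ℝ), 0 < ε → ∃ n, dS (En n) z < ε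

/-! ### Mazur's lemma -/

lemma mazur {Q : Type*} [NormedAddCommGroup Q] [NormedSpace ℝ Q] (w : ℕ → Q)
    (hw : ∀ φ : Q →L[ℝ] ℝ, Tendsto (fun n => φ (w n)) atTop (𝓝 0)) (ε : ℝ) (hε : 0 < ε) :
    ∃ a : ℕ →₀ ℝ, (∀ i, 0 ≤ a i) ∧ ∑ i ∈ a.support, a i = 1 ∧
      ‖∑ i ∈ a.support, a i • w i‖ < ε := by
  let S : Set (ℕ →₀ ℝ) := {a | (∀ i, 0 ≤ a i) ∧ Finsupp.linearCombination ℝ (fun _ => (1 : ℝ)) a = 1}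
  have hS : Convex ℝ S := by
    rintro a ⟨ha, ha1⟩ b ⟨hb, hb1⟩ s t hs ht hst
    refine ⟨fun i => ?_, ?_⟩
    · simp only [Finsupp.add_apply, Finsupp.smul_apply, smul_eq_mul]
      have := ha i; have := hb i; positivity
    · rw [map_add, map_smul, map_smul, ha1, hb1]; simpa using hst
  let G : Set Q := (Finsupp.linearCombination ℝ w) '' S
  have hG : Convex ℝ G := hS.linear_image _
  have h0 : (0 : Q) ∈ closure G := by
    by_contra h
    obtain ⟨f, u, hu, hf⟩ := geometric_hahn_banach_point_closed hG.closure isClosed_closure h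
    rw [map_zero] at hu
    have h2 : ∀ n, u < f (w n) := fun n => hf _ (subset_closure
      ⟨Finsupp.single n 1, ⟨fun i => by
        by_cases h : n = i <;> simp [Finsupp.single_apply, h], by simp⟩, by simp⟩)
    have h3 := ge_of_tendsto' (hw f) (fun n => (h2 n).le)
    linarith
  obtain ⟨y, ⟨a, ⟨ha, ha1⟩, rfl⟩, hy⟩ := Metric.mem_closure_iff.1 h0 ε hε
  refine ⟨a, ha, ?_, ?_⟩
  · simpa [Finsupp.linearCombination_apply, Finsupp.sum] using ha1
  · simpa [Finsupp.linearCombination_apply, Finsupp.sum, dist_eq_norm] using hy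

/-! ### Schur property from the chain inequality -/

section Schur
variable {Q : Type*} [NormedAddCommGroup Q] [NormedSpace ℝ Q]

lemma weaklyNull_dS (w : ℕ → Q) (hw : ∀ φ : Q →L[ℝ] ℝ, Tendsto (fun n => φ (w n)) atTop (𝓝 0))
    (h1 : ∀ n, ‖w n‖ = 1) (E : Submodule ℝ Q) [FiniteDimensional ℝ E] :
    ∀ᶠ k in atTop, 1 / 4 ≤ dS E (w k) := by
  obtain ⟨N, θ, hθ⟩ := exists_control E
  have h : Tendsto (fun n => ‖θ (w n)‖) atTop (𝓝 0) := by
    rw [← norm_zero (E := Fin N → ℝ)]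
    refine Tendsto.norm ?_
    rw [tendsto_pi_nhds]
    intro j
    exact hw ((ContinuousLinearMap.proj j).comp θ)
  filter_upwards [h.eventually_lt_const (show (0:ℝ) < 1 / 8 by norm_num)] with k hk
  have := hθ (w k)
  rw [h1] at this
  linarith

lemma schur_step {δ : ℝ} (hδ : 0 < δ) (hQ : HasChain Q δ) (w : ℕ → Q)
    (hw : ∀ φ : Q →L[ℝ] ℝ, Tendsto (fun n => φ (w n)) atTop (𝓝 0))
    (h1 : ∀ n, ‖w n‖ = 1) (q : Q) (t : ℝ) (ht : 0 ≤ t) (ht1 : t ≤ 1) (ε : ℝ) (hε : 0 < ε) :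
    ∀ᶠ k in atTop, ‖q‖ + t * (δ / 4) - ε ≤ ‖q + t • w k‖ := by
  obtain ⟨En, hfd, hch, -, hdense⟩ := hQ
  by_contra hcon
  rw [not_eventually] at hcon
  set e := ε / (5 + δ) with he
  have he0 : 0 < e := by positivity
  have hee : e * (5 + δ) = ε := by rw [he]; field_simp
  obtain ⟨n, hn⟩ := hdense q e he0
  haveI := hfd n
  have hev := hcon.and_eventually (weaklyNull_dS w hw h1 (En n))
  obtain ⟨k, hk, hkp⟩ := extraction_of_frequently_atTop hev
  obtain ⟨a, ha0, ha1, han⟩ := mazur (w ∘ k) (fun φ => (hw φ).comp hk.tendsto_atTop) e he0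
  have hC := (hch n).finset a.support (fun i => a i • (q + t • w (k i)))
  have hs : ∑ i ∈ a.support, a i • (q + t • w (k i)) = q + t • ∑ i ∈ a.support, a i • w (k i) := by
    simp only [smul_add, Finset.sum_add_distrib, ← Finset.sum_smul, ha1, one_smul, Finset.smul_sum]
    congr 1
    exact Finset.sum_congr rfl fun i _ => smul_comm _ _ _
  rw [hs] at hC
  set u := ∑ i ∈ a.support, a i • w (k i) with hu
  have hun : ‖u‖ < e := han
  have htu : ‖t • u‖ ≤ e := by
    rw [norm_smul, Real.norm_eq_abs, abs_of_nonneg ht]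
    nlinarith [norm_nonneg u]
  have g1 : ‖q‖ - e ≤ ‖q + t • u‖ := by
    have := norm_sub_le (q + t • u) (t • u)
    rw [add_sub_cancel_right] at this
    linarith
  have g2 : dS (En n) (q + t • u) ≤ 2 * e := by
    have := dS_add (En n) q (t • u)
    have := dS_le_norm (En n) (t • u)
    linarith
  have g3 : t / 4 - e ≤ ∑ i ∈ a.support, dS (En n) (a i • (q + t • w (k i))) := by
    calc t / 4 - e = ∑ i ∈ a.support, a i * (t / 4 - e) := by
          rw [← Finset.sum_mul, ha1, one_mul]
      _ ≤ _ := Finset.sum_le_sum fun i _ => by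
          rw [dS_smul, abs_of_nonneg (ha0 i)]
          refine mul_le_mul_of_nonneg_left ?_ (ha0 i)
          have h3 := dS_sub (En n) (q + t • w (k i)) q
          rw [add_sub_cancel_left, dS_smul, abs_of_nonneg ht] at h3
          have h4 := (hkp i).2
          nlinarith
  have g4 : ∑ i ∈ a.support, ‖a i • (q + t • w (k i))‖ ≤ ‖q‖ + t * (δ / 4) - ε := by
    calc _ ≤ ∑ i ∈ a.support, a i * (‖q‖ + t * (δ / 4) - ε) := Finset.sum_le_sum fun i _ => by
          rw [norm_smul, Real.norm_eq_abs, abs_of_nonneg (ha0 i)]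
          exact mul_le_mul_of_nonneg_left (not_le.1 (hkp i).1).le (ha0 i)
      _ = _ := by rw [← Finset.sum_mul, ha1, one_mul]
  have g5 := mul_le_mul_of_nonneg_left g3 hδ.le
  have hstrict : ‖q‖ - e < ‖q + t • u‖ := by
    have := norm_sub_le (q + t • u) (t • u)
    rw [add_sub_cancel_right] at this
    have htu' : ‖t • u‖ < e := by
      rw [norm_smul, Real.norm_eq_abs, abs_of_nonneg ht]
      nlinarith [norm_nonneg u]
    linarith
  nlinarith

lemma schur_step_compact {δ : ℝ} (hδ : 0 < δ) (hQ : HasChain Q δ) (w : ℕ → Q)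
    (hw : ∀ φ : Q →L[ℝ] ℝ, Tendsto (fun n => φ (w n)) atTop (𝓝 0))
    (h1 : ∀ n, ‖w n‖ = 1) (K : Set Q) (hK : IsCompact K) (ε : ℝ) (hε : 0 < ε) :
    ∀ᶠ k in atTop, ∀ q ∈ K, ∀ t ∈ Set.Icc (0:ℝ) 1,
      ‖q‖ + t * (δ / 4) - ε ≤ ‖q + t • w k‖ := by
  have hKc : IsCompact (K ×ˢ Set.Icc (0:ℝ) 1) := hK.prod isCompact_Icc
  have : ∀ᶠ k in atTop, ∀ p ∈ K ×ˢ Set.Icc (0:ℝ) 1,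
      ‖p.1‖ + p.2 * (δ / 4) - ε ≤ ‖p.1 + p.2 • w k‖ := by
    refine hKc.induction_on (p := fun s => ∀ᶠ k in atTop, ∀ p ∈ s,
      ‖p.1‖ + p.2 * (δ / 4) - ε ≤ ‖p.1 + p.2 • w k‖) (by simp) ?_ ?_ ?_
    · intro s t hst h
      filter_upwards [h] with k hk p hp using hk p (hst hp)
    · intro s t hs ht
      filter_upwards [hs, ht] with k hk hk' p hp
      exact hp.elim (hk p) (hk' p)
    · rintro ⟨q, t⟩ ⟨hq, ht⟩
      set e := ε / (4 + δ) with he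
      have he0 : 0 < e := by positivity
      have hee : e * (4 + δ) = ε := by rw [he]; field_simp
      refine ⟨Metric.ball (q, t) e, mem_nhdsWithin_of_mem_nhds (Metric.ball_mem_nhds _ he0), ?_⟩
      filter_upwards [schur_step hδ hQ w hw h1 q t ht.1 ht.2 e he0] with k hk
      rintro ⟨q', t'⟩ hp
      rw [Metric.mem_ball, Prod.dist_eq, max_lt_iff] at hp
      obtain ⟨hp1, hp2⟩ := hp
      simp only [dist_eq_norm, Real.norm_eq_abs] at hp1 hp2
      dsimp only
      have a1 : ‖q'‖ ≤ ‖q‖ + e := by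
        have := norm_add_le q (q' - q)
        rw [add_sub_cancel] at this
        linarith
      have a2 : ‖q + t • w k‖ ≤ ‖q' + t' • w k‖ + 2 * e := by
        have hx : q + t • w k = (q' + t' • w k) - ((q' - q) + (t' - t) • w k) := by
          rw [sub_smul]; abel
        rw [hx]
        refine (norm_sub_le _ _).trans ?_
        have := norm_add_le (q' - q) ((t' - t) • w k)
        rw [norm_smul, h1, mul_one, Real.norm_eq_abs] at this
        linarith
      have a3 := (abs_lt.1 hp2).2
      nlinarith
  filter_upwards [this] with k hk q hq t ht using hk (q, t) ⟨hq, ht⟩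

lemma schur_contra {δ : ℝ} (hδ : 0 < δ) (hQ : HasChain Q δ) (w : ℕ → Q)
    (hw : ∀ φ : Q →L[ℝ] ℝ, Tendsto (fun n => φ (w n)) atTop (𝓝 0))
    (h1 : ∀ n, ‖w n‖ = 1) : False := by
  let ε : ℕ → ℝ := fun m => δ / 16 * (1 / 2) ^ m
  have hε : ∀ m, 0 < ε m := fun m => by positivity
  have H : ∀ (m : ℕ) (K : {K : Set Q // IsCompact K}), ∃ k, m ≤ k ∧ ∀ q ∈ K.1,
      ∀ t ∈ Set.Icc (0:ℝ) 1, ‖q‖ + t * (δ / 4) - ε m ≤ ‖q + t • w k‖ := fun m K =>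
    (((eventually_ge_atTop m).and
      (schur_step_compact hδ hQ w hw h1 K.1 K.2 (ε m) (hε m)))).exists
  choose κ hκ hκ2 using H
  let nxt : ℕ → {K : Set Q // IsCompact K} → {K : Set Q // IsCompact K} := fun m K =>
    ⟨(fun p : Q × ℝ => p.1 + p.2 • w (κ m K)) '' (K.1 ×ˢ Set.Icc (0:ℝ) 1),
      (K.2.prod isCompact_Icc).image (by fun_prop)⟩
  let S : ℕ → {K : Set Q // IsCompact K} := fun m =>
    Nat.rec ⟨{0}, isCompact_singleton⟩ (fun m K => nxt m K) m
  have hS : ∀ m, S (m+1) = nxt m (S m) := fun m => rfl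
  let k : ℕ → ℕ := fun m => κ m (S m)
  have hk : Tendsto k atTop atTop := tendsto_atTop_mono (fun m => hκ m (S m)) tendsto_id
  have key : ∀ (a : ℕ → ℝ), (∀ i, a i ∈ Set.Icc (0:ℝ) 1) → ∀ m,
      (∑ i ∈ Finset.range m, a i • w (k i)) ∈ (S m).1 ∧
      (δ / 4) * ∑ i ∈ Finset.range m, a i - ∑ i ∈ Finset.range m, ε i ≤
        ‖∑ i ∈ Finset.range m, a i • w (k i)‖ := by
    intro a ha m
    induction m with
    | zero => exact ⟨by simp [S], by simp⟩
    | succ m ih =>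
      simp only [Finset.sum_range_succ]
      refine ⟨?_, ?_⟩
      · rw [hS]
        exact ⟨(_, a m), ⟨ih.1, ha m⟩, rfl⟩
      · have := hκ2 m (S m) _ ih.1 (a m) (ha m)
        have h2 := ih.2
        change _ ≤ ‖_ + a m • w (κ m (S m))‖
        linarith
  obtain ⟨a, ha0, ha1, han⟩ := mazur (w ∘ k) (fun φ => (hw φ).comp hk) (δ / 8) (by positivity)
  have hale : ∀ i, a i ≤ 1 := by
    intro i
    by_cases hi : i ∈ a.support
    · rw [← ha1]; exact Finset.single_le_sum (fun j _ => ha0 j) hi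
    · rw [Finsupp.notMem_support_iff.1 hi]; exact zero_le_one
  obtain ⟨m, hm⟩ := a.support.exists_nat_subset_range
  have e1 : ∑ i ∈ Finset.range m, a i = 1 := by
    rw [← ha1]
    exact (Finset.sum_subset hm fun i _ hi => Finsupp.notMem_support_iff.1 hi).symm
  have e2 : ∑ i ∈ Finset.range m, a i • w (k i) = ∑ i ∈ a.support, a i • (w ∘ k) i :=
    (Finset.sum_subset hm fun i _ hi => by
      rw [Finsupp.notMem_support_iff.1 hi, zero_smul]).symm
  have h3 := (key a (fun i => ⟨ha0 i, hale i⟩) m).2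
  rw [e1, e2] at h3
  have e3 : ∑ i ∈ Finset.range m, ε i ≤ δ / 8 := by
    rw [← Finset.mul_sum]
    have : ∑ i ∈ Finset.range m, (1/2:ℝ)^i ≤ 2 := by
      have := Summable.sum_le_tsum (Finset.range m) (fun i _ => by positivity) summable_geometric_two
      rwa [tsum_geometric_two] at this
    nlinarith
  linarith

theorem hasSchur_of_hasChain {δ : ℝ} (hδ : 0 < δ) (hQ : HasChain Q δ) : HasSchurProperty Q := by
  intro f x hf
  by_contra hcon
  rw [Metric.tendsto_atTop] at hcon
  push Not at hcon
  obtain ⟨ε, hε, h⟩ := hcon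
  have hfr : ∃ᶠ n in atTop, ε ≤ dist (f n) x := frequently_atTop.2 h
  obtain ⟨k, hk, hkp⟩ := extraction_of_frequently_atTop hfr
  have hpos : ∀ n, 0 < ‖f (k n) - x‖ := fun n => by
    have := hkp n; rw [dist_eq_norm] at this; linarith
  refine schur_contra hδ hQ (fun n => ‖f (k n) - x‖⁻¹ • (f (k n) - x)) (fun φ => ?_) (fun n => ?_)
  · have h0 : Tendsto (fun n => φ (f (k n) - x)) atTop (𝓝 0) := by
      have := ((hf φ).comp hk.tendsto_atTop).sub_const (φ x)
      simpa using this
    have h1 := h0.abs.const_mul ε⁻¹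
    simp only [abs_zero, mul_zero] at h1
    refine squeeze_zero_norm (fun n => ?_) h1
    rw [map_smul, smul_eq_mul, Real.norm_eq_abs, abs_mul, abs_inv, abs_norm]
    have h2 := hkp n
    rw [dist_eq_norm] at h2
    exact mul_le_mul_of_nonneg_right (inv_anti₀ hε h2) (abs_nonneg _)
  · rw [norm_smul, norm_inv, norm_norm, inv_mul_cancel₀ (hpos n).ne']

end Schur

/-! ### Radon-Nikodym property from the chain inequality -/

section RNP
variable {Ω : Type*} [MeasurableSpace Ω]

/-- `g'` refines `g` as a finite partition. -/
def RefBy (g' g : SimpleFunc Ω ℕ) : Prop := ∃ h : ℕ → ℕ, ∀ x, g x = h (g' x)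

lemma RefBy.refl (g : SimpleFunc Ω ℕ) : RefBy g g := ⟨id, fun _ => rfl⟩

lemma RefBy.trans {g₁ g₂ g₃ : SimpleFunc Ω ℕ} (h : RefBy g₁ g₂) (h' : RefBy g₂ g₃) :
    RefBy g₁ g₃ := by
  obtain ⟨a, ha⟩ := h
  obtain ⟨b, hb⟩ := h'
  exact ⟨b ∘ a, fun x => by rw [hb, ha]; rfl⟩

/-- Common refinement of two finite partitions. -/
def joinP (g g' : SimpleFunc Ω ℕ) : SimpleFunc Ω ℕ := (g.pair g').map fun p => Nat.pair p.1 p.2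

lemma joinP_left (g g' : SimpleFunc Ω ℕ) : RefBy (joinP g g') g :=
  ⟨fun n => n.unpair.1, fun x => by simp [joinP]⟩

lemma joinP_right (g g' : SimpleFunc Ω ℕ) : RefBy (joinP g g') g' :=
  ⟨fun n => n.unpair.2, fun x => by simp [joinP]⟩

lemma exists_common_ref {N : ℕ} (g : Fin N → SimpleFunc Ω ℕ) :
    ∃ g', ∀ j, RefBy g' (g j) := by
  induction N with
  | zero => exact ⟨SimpleFunc.const _ 0, fun j => j.elim0⟩
  | succ N ih =>
    obtain ⟨g', hg'⟩ := ih (fun j => g j.succ)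
    refine ⟨joinP (g 0) g', fun j => ?_⟩
    refine Fin.cases ?_ (fun i => ?_) j
    · exact joinP_left _ _
    · exact (joinP_right _ _).trans (hg' i)

lemma cells_union (g : SimpleFunc Ω ℕ) (A : Set Ω) :
    A = ⋃ k ∈ g.range, (A ∩ g ⁻¹' {k}) := by
  ext x; simp

lemma cells_disj (g : SimpleFunc Ω ℕ) (A : Set Ω) (s : Set ℕ) :
    s.PairwiseDisjoint (fun k => A ∩ g ⁻¹' {k}) := by
  intro i _ j _ hij
  refine Set.disjoint_left.2 fun x hx hx' => hij ?_
  have h1 : g x = i := hx.2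
  have h2 : g x = j := hx'.2
  rw [← h1, ← h2]

lemma cells_meas (g : SimpleFunc Ω ℕ) {A : Set Ω} (hA : MeasurableSet A) (k : ℕ) :
    MeasurableSet (A ∩ g ⁻¹' {k}) := hA.inter (g.measurableSet_preimage _)

lemma integral_cells (μ : Measure Ω) [IsFiniteMeasure μ] {E : Type*} [NormedAddCommGroup E]
    [NormedSpace ℝ E] [CompleteSpace E] (g : SimpleFunc Ω ℕ) (F : ℕ → E) {A : Set Ω}
    (hA : MeasurableSet A) :
    ∫ x in A, F (g x) ∂μ = ∑ k ∈ g.range, μ.real (A ∩ g ⁻¹' {k}) • F k := by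
  have hInt : Integrable (fun x => F (g x)) μ := (g.map F).integrable_of_isFiniteMeasure
  conv_lhs => rw [cells_union g A]
  rw [integral_biUnion_finset g.range (fun k _ => cells_meas g hA k) (cells_disj g A _)
    (fun k _ => hInt.integrableOn)]
  refine Finset.sum_congr rfl fun k _ => ?_
  rw [setIntegral_congr_fun (g := fun _ => F k) (cells_meas g hA k), setIntegral_const]
  intro x hx
  have : g x = k := hx.2
  simp only [this]

lemma integral_cells_univ (μ : Measure Ω) [IsFiniteMeasure μ] {E : Type*} [NormedAddCommGroup E]
    [NormedSpace ℝ E] [CompleteSpace E] (g : SimpleFunc Ω ℕ) (F : ℕ → E) :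
    ∫ x, F (g x) ∂μ = ∑ k ∈ g.range, μ.real (g ⁻¹' {k}) • F k := by
  have := integral_cells μ g F MeasurableSet.univ
  simpa using this

variable {Q : Type*} [NormedAddCommGroup Q] [NormedSpace ℝ Q]

lemma vm_cells (τ : VectorMeasure Ω Q) (g : SimpleFunc Ω ℕ) {A : Set Ω}
    (hA : MeasurableSet A) : τ A = ∑ k ∈ g.range, τ (A ∩ g ⁻¹' {k}) := by
  conv_lhs => rw [cells_union g A]
  rw [VectorMeasure.of_biUnion_finset (cells_disj g A _) (fun k _ => cells_meas g hA k)]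

/-- Average value of the vector measure on a cell. -/
noncomputable def avgV (μ : Measure Ω) (τ : VectorMeasure Ω Q) (g : SimpleFunc Ω ℕ) (k : ℕ) : Q :=
  (μ.real (g ⁻¹' {k}))⁻¹ • τ (g ⁻¹' {k})

variable (μ : Measure Ω) [IsFiniteMeasure μ] (τ : VectorMeasure Ω Q)

lemma avgV_smul
    (hac : ∀ s : Set Ω, MeasurableSet s → μ s = 0 → τ s = 0)
    (g : SimpleFunc Ω ℕ) (k : ℕ) :
    μ.real (g ⁻¹' {k}) • avgV μ τ g k = τ (g ⁻¹' {k}) := by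
  unfold avgV
  by_cases h : μ.real (g ⁻¹' {k}) = 0
  · rw [hac _ (g.measurableSet_preimage _), h, zero_smul]
    rwa [measureReal_eq_zero_iff] at h
  · rw [smul_inv_smul₀ h]

lemma avg_integrable (g : SimpleFunc Ω ℕ) : Integrable (fun x => avgV μ τ g (g x)) μ :=
  (g.map (avgV μ τ g)).integrable_of_isFiniteMeasure

lemma avg_setIntegral
    (hac : ∀ s : Set Ω, MeasurableSet s → μ s = 0 → τ s = 0)
    [CompleteSpace Q] (g a : SimpleFunc Ω ℕ) (h : RefBy g a) (k : ℕ) :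
    ∫ x in a ⁻¹' {k}, avgV μ τ g (g x) ∂μ = τ (a ⁻¹' {k}) := by
  obtain ⟨h, hh⟩ := h
  have hA : MeasurableSet (a ⁻¹' {k}) := a.measurableSet_preimage _
  rw [integral_cells μ g _ hA, vm_cells τ g hA]
  refine Finset.sum_congr rfl fun l _ => ?_
  by_cases hl : h l = k
  · have : a ⁻¹' {k} ∩ g ⁻¹' {l} = g ⁻¹' {l} := by
      refine Set.inter_eq_right.2 fun x hx => ?_
      have hx' : g x = l := hx
      simp [hh, hx', hl]
    rw [this, avgV_smul μ τ hac]
  · have : a ⁻¹' {k} ∩ g ⁻¹' {l} = ∅ := by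
      refine Set.eq_empty_of_forall_notMem fun x hx => hl ?_
      have hx' : g x = l := hx.2
      have hx2 : a x = k := hx.1
      rw [← hx2, hh, hx']
    simp [this]

lemma integral_dS_avg
    (hac : ∀ s : Set Ω, MeasurableSet s → μ s = 0 → τ s = 0)
    (E : Submodule ℝ Q) (g : SimpleFunc Ω ℕ) :
    ∫ x, dS E (avgV μ τ g (g x)) ∂μ = ∑ k ∈ g.range, dS E (τ (g ⁻¹' {k})) := by
  rw [integral_cells_univ μ g (fun k => dS E (avgV μ τ g k))]
  refine Finset.sum_congr rfl fun k _ => ?_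
  rw [← avgV_smul μ τ hac, dS_smul, abs_of_nonneg measureReal_nonneg, smul_eq_mul]

lemma rnp_var (C : ℝ) (hC : ∀ P : Finset (Set Ω), (∀ s ∈ P, MeasurableSet s) →
        ((P : Set (Set Ω)).Pairwise fun s t => Disjoint s t) →
        ∑ s ∈ P, ‖τ s‖ ≤ C) (g : SimpleFunc Ω ℕ) :
    ∑ k ∈ g.range, ‖τ (g ⁻¹' {k})‖ ≤ C := by
  classical
  have hinj : Set.InjOn (fun k => g ⁻¹' {k}) (g.range : Set ℕ) := by
    intro i hi j hj hij
    obtain ⟨x, rfl⟩ := SimpleFunc.mem_range.1 (Finset.mem_coe.1 hi)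
    have : x ∈ g ⁻¹' {g x} := rfl
    simp only at hij
    rw [hij] at this
    exact this
  have := hC (g.range.image fun k => g ⁻¹' {k}) ?_ ?_
  · rwa [Finset.sum_image hinj] at this
  · intro s hs
    obtain ⟨k, -, rfl⟩ := Finset.mem_image.1 hs
    exact g.measurableSet_preimage _
  · intro s hs t ht hst
    obtain ⟨k, -, rfl⟩ := Finset.mem_image.1 (Finset.mem_coe.1 hs)
    obtain ⟨l, -, rfl⟩ := Finset.mem_image.1 (Finset.mem_coe.1 ht)
    have := cells_disj g Set.univ Set.univ (Set.mem_univ k) (Set.mem_univ l)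
      (fun h => hst (by rw [h]))
    simpa [Function.onFun] using this

lemma rnp_small {δ : ℝ} (hδ : 0 < δ) (En : ℕ → Submodule ℝ Q) (hch : ∀ n, ChainIneq δ (En n))
    (hmono : Monotone En) (hden : ∀ (z : Q) (ε : ℝ), 0 < ε → ∃ n, dS (En n) z < ε)
    (C : ℝ) (hC : ∀ g : SimpleFunc Ω ℕ, ∑ k ∈ g.range, ‖τ (g ⁻¹' {k})‖ ≤ C)
    (ε : ℝ) (hε : 0 < ε) :
    ∃ (n : ℕ) (g₀ : SimpleFunc Ω ℕ), ∀ g', RefBy g' g₀ →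
      ∑ l ∈ g'.range, dS (En n) (τ (g' ⁻¹' {l})) ≤ ε := by
  classical
  set e := δ * ε / 3 with he
  have he0 : 0 < e := by positivity
  let V : SimpleFunc Ω ℕ → ℝ := fun g => ∑ k ∈ g.range, ‖τ (g ⁻¹' {k})‖
  have hbdd : BddAbove (Set.range V) := ⟨C, by rintro _ ⟨g, rfl⟩; exact hC g⟩
  have hne : (Set.range V).Nonempty := ⟨_, SimpleFunc.const _ 0, rfl⟩
  obtain ⟨_, ⟨g₀, rfl⟩, hg₀⟩ := exists_lt_of_lt_csSup hne (sub_lt_self (sSup (Set.range V)) he0)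
  have hV : ∀ g', V g' ≤ V g₀ + e := fun g' => by
    have := le_csSup hbdd ⟨g', rfl⟩
    linarith
  have hn : ∃ n, ∑ k ∈ g₀.range, dS (En n) (τ (g₀ ⁻¹' {k})) ≤ e := by
    choose N hN using fun k => hden (τ (g₀ ⁻¹' {k})) (e / (g₀.range.card + 1)) (by positivity)
    refine ⟨g₀.range.sup N, ?_⟩
    calc _ ≤ ∑ k ∈ g₀.range, e / (g₀.range.card + 1) := Finset.sum_le_sum fun k hk =>
          (dS_anti (hmono (Finset.le_sup hk)) _).trans (hN k).le
      _ = g₀.range.card * (e / (g₀.range.card + 1)) := by rw [Finset.sum_const, nsmul_eq_mul]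
      _ ≤ e := by
          rw [mul_div_assoc', div_le_iff₀ (by positivity)]
          nlinarith
  obtain ⟨n, hn⟩ := hn
  refine ⟨n, g₀, fun g' hg' => ?_⟩
  obtain ⟨h, hh⟩ := hg'
  have hmaps : ∀ l ∈ g'.range, h l ∈ g₀.range := by
    intro l hl
    obtain ⟨x, rfl⟩ := SimpleFunc.mem_range.1 hl
    rw [← hh]; exact g₀.mem_range_self x
  have hdec : ∀ k, τ (g₀ ⁻¹' {k}) = ∑ l ∈ g'.range with h l = k, τ (g' ⁻¹' {l}) := by
    intro k
    rw [vm_cells τ g' (g₀.measurableSet_preimage _), Finset.sum_filter]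
    refine Finset.sum_congr rfl fun l _ => ?_
    split_ifs with hl
    · congr 1
      refine Set.inter_eq_right.2 fun x hx => ?_
      have hx' : g' x = l := hx
      simp [hh, hx', hl]
    · have : g₀ ⁻¹' {k} ∩ g' ⁻¹' {l} = ∅ := by
        refine Set.eq_empty_of_forall_notMem fun x hx => hl ?_
        have hx' : g' x = l := hx.2
        have hx2 : g₀ x = k := hx.1
        rw [← hx2, hh, hx']
      rw [this, VectorMeasure.empty]
  have hsum := Finset.sum_le_sum fun k (_ : k ∈ g₀.range) =>
    (hch n).finset (g'.range.filter fun l => h l = k) (fun l => τ (g' ⁻¹' {l}))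
  simp only [← hdec, Finset.sum_add_distrib, ← Finset.mul_sum] at hsum
  rw [Finset.sum_fiberwise_of_maps_to hmaps (fun l => dS (En n) (τ (g' ⁻¹' {l}))),
    Finset.sum_fiberwise_of_maps_to hmaps (fun l => ‖τ (g' ⁻¹' {l})‖)] at hsum
  have h2 := hV g'
  simp only [V] at h2
  have h3 : δ * ∑ l ∈ g'.range, dS (En n) (τ (g' ⁻¹' {l})) ≤ δ * ε := by
    have : δ * ε = 3 * e := by rw [he]; ring
    linarith
  exact le_of_mul_le_mul_left h3 hδ

lemma rnp_scalar_density
    (hac : ∀ s : Set Ω, MeasurableSet s → μ s = 0 → τ s = 0)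
    (φ : Q →L[ℝ] ℝ) : ∃ h : Ω → ℝ, Integrable h μ ∧
    ∀ A, MeasurableSet A → φ (τ A) = ∫ x in A, h x ∂μ := by
  let ν : SignedMeasure Ω := τ.mapRange φ.toLinearMap.toAddMonoidHom φ.continuous
  refine ⟨ν.rnDeriv μ, SignedMeasure.integrable_rnDeriv _ _, fun A hA => ?_⟩
  have hν : VectorMeasure.AbsolutelyContinuous ν μ.toENNRealVectorMeasure := by
    intro s hs
    by_cases hm : MeasurableSet s
    · rw [Measure.toENNRealVectorMeasure_apply_measurable hm] at hs
      change φ (τ s) = 0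
      rw [hac s hm hs, map_zero]
    · exact ν.not_measurable hm
  have := SignedMeasure.withDensityᵥ_rnDeriv_eq ν μ hν
  rw [← withDensityᵥ_apply (SignedMeasure.integrable_rnDeriv ν μ) hA, this]
  rfl

lemma rnp_scalar
    (hac : ∀ s : Set Ω, MeasurableSet s → μ s = 0 → τ s = 0)
    (φ : Q →L[ℝ] ℝ) (ε : ℝ) (hε : 0 < ε) :
    ∃ g : SimpleFunc Ω ℕ, ∀ g' g'', RefBy g' g → RefBy g'' g →
      ∫ x, |φ (avgV μ τ g' (g' x)) - φ (avgV μ τ g'' (g'' x))| ∂μ ≤ ε := by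
  classical
  obtain ⟨h, hInt, hh⟩ := rnp_scalar_density μ τ hac φ
  obtain ⟨s, hs, hsm⟩ := (memLp_one_iff_integrable.2 hInt).exists_simpleFunc_eLpNorm_sub_lt
    (by simp) (ε := ENNReal.ofReal (ε / 2)) (by simpa using hε)
  have hsint : Integrable s μ := memLp_one_iff_integrable.1 hsm
  have hs' : ∫ x, |h x - s x| ∂μ ≤ ε / 2 := by
    have h1 := (hInt.sub hsint)
    have h2 : ∫ x, ‖h x - s x‖ ∂μ = (eLpNorm (h - ⇑s) 1 μ).toReal := by
      rw [eLpNorm_one_eq_lintegral_enorm]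
      exact integral_norm_eq_lintegral_enorm h1.aestronglyMeasurable
    simp only [Real.norm_eq_abs] at h2
    rw [h2]
    exact ENNReal.toReal_le_of_le_ofReal (by positivity) hs.le
  let c : ℝ → ℕ := fun y => s.range.toList.idxOf y
  let d : ℕ → ℝ := fun n => s.range.toList.getD n 0
  have hcd : ∀ x, s x = d (c (s x)) := by
    intro x
    have hm : s x ∈ s.range.toList := by simp
    have hlt := List.idxOf_lt_length_iff.2 hm
    simp only [c, d]
    rw [List.getD_eq_getElem _ _ hlt, List.getElem_idxOf]
  have main : ∀ g', RefBy g' (s.map c) → ∫ x, |φ (avgV μ τ g' (g' x)) - s x| ∂μ ≤ ε / 2 := by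
    rintro g' ⟨r, hr⟩
    refine le_trans ?_ hs'
    have e1 : ∀ x, s x = d (r (g' x)) := fun x => by
      rw [← hr]; exact hcd x
    have e2 : ∫ x, |φ (avgV μ τ g' (g' x)) - s x| ∂μ =
        ∫ x, (fun k => |φ (avgV μ τ g' k) - d (r k)|) (g' x) ∂μ := by
      simp only [← e1]
    rw [e2, integral_cells_univ μ g' (fun k => |φ (avgV μ τ g' k) - d (r k)|)]
    have e3 : ∫ x, |h x - s x| ∂μ = ∑ k ∈ g'.range, ∫ x in g' ⁻¹' {k}, |h x - s x| ∂μ := by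
      have := integral_biUnion_finset (μ := μ) (f := fun x => |h x - s x|) g'.range
        (fun k _ => cells_meas g' MeasurableSet.univ k) (cells_disj g' Set.univ _)
        (fun k _ => (hInt.sub hsint).abs.integrableOn)
      rw [← cells_union g' Set.univ] at this
      simpa using this
    rw [e3]
    refine Finset.sum_le_sum fun k _ => ?_
    have hm : MeasurableSet (g' ⁻¹' {k}) := g'.measurableSet_preimage _
    have e4 : ∫ x in g' ⁻¹' {k}, s x ∂μ = μ.real (g' ⁻¹' {k}) * d (r k) := by
      rw [setIntegral_congr_fun (g := fun _ => d (r k)) hm, setIntegral_const, smul_eq_mul]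
      intro x hx
      have hx' : g' x = k := hx
      simp only [e1, hx']
    have e5 : μ.real (g' ⁻¹' {k}) * (φ (avgV μ τ g' k) - d (r k)) =
        ∫ x in g' ⁻¹' {k}, (h x - s x) ∂μ := by
      rw [integral_sub hInt.integrableOn hsint.integrableOn, e4, ← hh _ hm,
        ← avgV_smul μ τ hac, map_smul, smul_eq_mul]
      ring
    rw [smul_eq_mul]
    nth_rewrite 1 [← abs_of_nonneg (measureReal_nonneg (μ := μ) (s := g' ⁻¹' {k}))]
    rw [← abs_mul, e5]
    exact abs_integral_le_integral_abs
  refine ⟨s.map c, fun g' g'' h' h'' => ?_⟩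
  have i1 : ∀ g' : SimpleFunc Ω ℕ, Integrable (fun x => |φ (avgV μ τ g' (g' x)) - s x|) μ := fun g' =>
    ((φ.integrable_comp (avg_integrable μ τ g')).sub hsint).abs
  calc _ ≤ ∫ x, (|φ (avgV μ τ g' (g' x)) - s x| + |φ (avgV μ τ g'' (g'' x)) - s x|) ∂μ := by
        refine integral_mono ?_ ((i1 g').add (i1 g'')) fun x => ?_
        · exact ((φ.integrable_comp (avg_integrable μ τ g')).sub
            (φ.integrable_comp (avg_integrable μ τ g''))).abs
        · have := abs_sub_le (φ (avgV μ τ g' (g' x))) (s x) (φ (avgV μ τ g'' (g'' x)))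
          rw [abs_sub_comm (s x)] at this
          exact this
    _ ≤ ε := by
        rw [integral_add (i1 g') (i1 g'')]
        linarith [main g' h', main g'' h'']

lemma rnp_cauchy
    (hac : ∀ s : Set Ω, MeasurableSet s → μ s = 0 → τ s = 0)
    {δ : ℝ} (hδ : 0 < δ) (hQ : HasChain Q δ)
    (C : ℝ) (hC : ∀ g : SimpleFunc Ω ℕ, ∑ k ∈ g.range, ‖τ (g ⁻¹' {k})‖ ≤ C)
    (ε : ℝ) (hε : 0 < ε) :
    ∃ g : SimpleFunc Ω ℕ, ∀ g' g'', RefBy g' g → RefBy g'' g →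
      ∫ x, ‖avgV μ τ g' (g' x) - avgV μ τ g'' (g'' x)‖ ∂μ ≤ ε := by
  obtain ⟨En, hfd, hch, hmono, hden⟩ := hQ
  obtain ⟨n, g₀, hg₀⟩ := rnp_small τ hδ En hch hmono hden C hC (ε / 12) (by positivity)
  have := hfd n
  obtain ⟨N, θ, hθ⟩ := exists_control (En n)
  choose gs hgs using fun j : Fin N => rnp_scalar μ τ hac
    ((ContinuousLinearMap.proj j).comp θ) (ε / (4 * (N + 1))) (by positivity)
  obtain ⟨g₁, hg₁⟩ := exists_common_ref gs
  refine ⟨joinP g₀ g₁, fun g' g'' h' h'' => ?_⟩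
  have j0 := hg₀ g' (h'.trans (joinP_left _ _))
  have j0' := hg₀ g'' (h''.trans (joinP_left _ _))
  rw [← integral_dS_avg μ τ hac] at j0 j0'
  have j1 := fun j => hgs j g' g'' ((h'.trans (joinP_right _ _)).trans (hg₁ j))
    ((h''.trans (joinP_right _ _)).trans (hg₁ j))
  have iD : ∀ g' : SimpleFunc Ω ℕ, Integrable (fun x => dS (En n) (avgV μ τ g' (g' x))) μ := fun g' =>
    (g'.map fun k => dS (En n) (avgV μ τ g' k)).integrable_of_isFiniteMeasure
  have iS : ∀ j : Fin N, Integrable (fun x => |((ContinuousLinearMap.proj j).comp θ) (avgV μ τ g' (g' x))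
      - ((ContinuousLinearMap.proj (R := ℝ) j).comp θ) (avgV μ τ g'' (g'' x))|) μ := fun j =>
    ((ContinuousLinearMap.integrable_comp _ (avg_integrable μ τ g')).sub
            (ContinuousLinearMap.integrable_comp _ (avg_integrable μ τ g''))).abs
  calc _ ≤ ∫ x, (2 * (∑ j : Fin N, |((ContinuousLinearMap.proj j).comp θ) (avgV μ τ g' (g' x))
      - ((ContinuousLinearMap.proj (R := ℝ) j).comp θ) (avgV μ τ g'' (g'' x))|) +
      3 * (dS (En n) (avgV μ τ g' (g' x)) + dS (En n) (avgV μ τ g'' (g'' x)))) ∂μ := by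
        refine integral_mono ((avg_integrable μ τ g').sub (avg_integrable μ τ g'')).norm ?_ ?_
        · exact ((integrable_finsetSum _ fun j _ => iS j).const_mul 2).add
            (((iD g').add (iD g'')).const_mul 3)
        · intro x
          refine (hθ _).trans ?_
          have k1 := dS_sub (En n) (avgV μ τ g' (g' x)) (avgV μ τ g'' (g'' x))
          have k2 : ‖θ (avgV μ τ g' (g' x) - avgV μ τ g'' (g'' x))‖ ≤
              ∑ j : Fin N, |((ContinuousLinearMap.proj j).comp θ) (avgV μ τ g' (g' x))
      - ((ContinuousLinearMap.proj (R := ℝ) j).comp θ) (avgV μ τ g'' (g'' x))| := by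
            rw [pi_norm_le_iff_of_nonneg (Finset.sum_nonneg fun j _ => abs_nonneg _)]
            intro j
            refine le_trans ?_ (Finset.single_le_sum (f := fun j : Fin N =>
              |((ContinuousLinearMap.proj j).comp θ) (avgV μ τ g' (g' x))
      - ((ContinuousLinearMap.proj (R := ℝ) j).comp θ) (avgV μ τ g'' (g'' x))|)
              (fun j _ => abs_nonneg _) (Finset.mem_univ j))
            simp
          linarith
    _ ≤ ε := by
        have hE : Integrable (fun x => dS (En n) (avgV μ τ g' (g' x)) +
            dS (En n) (avgV μ τ g'' (g'' x))) μ := (iD g').add (iD g'')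
        rw [integral_add ((integrable_finsetSum _ fun j _ => iS j).const_mul 2)
            (hE.const_mul 3), integral_const_mul, integral_const_mul,
            integral_finset_sum _ (fun j _ => iS j), integral_add (iD g') (iD g'')]
        have hs : ∑ j : Fin N, ∫ x, |((ContinuousLinearMap.proj j).comp θ) (avgV μ τ g' (g' x))
      - ((ContinuousLinearMap.proj (R := ℝ) j).comp θ) (avgV μ τ g'' (g'' x))| ∂μ ≤ ε / 4 := by
          refine (Finset.sum_le_sum fun j _ => j1 j).trans ?_
          rw [Finset.sum_const, nsmul_eq_mul, Finset.card_univ, Fintype.card_fin, mul_div_assoc',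
            div_le_div_iff₀ (by positivity) (by positivity)]
          nlinarith
        linarith

end RNP

theorem hasRNP_of_hasChain {Q : Type*} [NormedAddCommGroup Q] [NormedSpace ℝ Q] [CompleteSpace Q]
    {δ : ℝ} (hδ : 0 < δ) (hQ : HasChain Q δ) : HasRNP Q := by
  classical
  intro Ω _ μ hμ τ hac ⟨C, hC⟩
  have hC' := rnp_var τ C hC
  choose G hG using fun k : ℕ => rnp_cauchy μ τ hac hδ hQ C hC' ((1/2 : ℝ) ^ k) (by positivity)
  let H : ℕ → SimpleFunc Ω ℕ := fun k => Nat.rec (G 0) (fun k g => joinP g (G (k+1))) k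
  have hHG : ∀ k, RefBy (H k) (G k) := by
    intro k
    cases k with
    | zero => exact RefBy.refl _
    | succ k => exact joinP_right _ _
  have hHH : ∀ k, RefBy (H (k+1)) (H k) := fun k => joinP_left _ _
  let f : ℕ → Ω → Q := fun k x => avgV μ τ (H k) (H k x)
  have hfi : ∀ k, Integrable (f k) μ := fun k => avg_integrable μ τ (H k)
  let F : ℕ → Lp Q 1 μ := fun k => (hfi k).toL1
  have hd : ∀ (a b : Ω → Q) (ha : Integrable a μ) (hb : Integrable b μ),
      dist (ha.toL1 a) (hb.toL1 b) = ∫ x, ‖a x - b x‖ ∂μ := by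
    intro a b ha hb
    rw [dist_eq_norm, ← Integrable.toL1_sub, L1.norm_of_fun_eq_integral_norm]
    rfl
  have hcs : CauchySeq F := by
    refine cauchySeq_of_le_geometric (1/2) 1 (by norm_num) fun k => ?_
    rw [hd, one_mul]
    exact hG k _ _ (hHG k) ((hHH k).trans (hHG k))
  obtain ⟨f0, hf0⟩ := cauchySeq_tendsto_of_complete hcs
  refine ⟨f0, L1.integrable_coeFn f0, fun A hA => ?_⟩
  have hlim : Tendsto (fun k => ∫ x, ‖f k x - f0 x‖ ∂μ) atTop (𝓝 0) := by
    have h1 := tendsto_iff_dist_tendsto_zero.1 hf0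
    refine h1.congr fun k => ?_
    conv_lhs => rw [← Integrable.toL1_coeFn f0 (L1.integrable_coeFn f0)]
    rw [hd]
  have hset : ∀ a b : Ω → Q, Integrable a μ → Integrable b μ →
      ‖∫ x in A, a x ∂μ - ∫ x in A, b x ∂μ‖ ≤ ∫ x, ‖a x - b x‖ ∂μ := by
    intro a b ha hb
    rw [← integral_sub ha.integrableOn hb.integrableOn]
    refine (norm_integral_le_integral_norm _).trans ?_
    exact setIntegral_le_integral (ha.sub hb).norm (Eventually.of_forall fun x => norm_nonneg _)
  let iA : SimpleFunc Ω ℕ := SimpleFunc.piecewise A hA (SimpleFunc.const _ 1) (SimpleFunc.const _ 0)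
  have hiA : iA ⁻¹' {1} = A := by
    ext x
    by_cases hx : x ∈ A <;> simp [iA, hx]
  have hb : ∀ k, ‖τ A - ∫ x in A, f0 x ∂μ‖ ≤ (1/2 : ℝ) ^ k + ∫ x, ‖f k x - f0 x‖ ∂μ := by
    intro k
    have e1 := avg_setIntegral μ τ hac (joinP (H k) iA) iA (joinP_right _ _) 1
    rw [hiA] at e1
    have e2 := hset _ _ (avg_integrable μ τ (joinP (H k) iA)) (hfi k)
    rw [e1] at e2
    have e3 := hG k _ _ ((joinP_left (H k) iA).trans (hHG k)) (hHG k)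
    have e4 := hset _ _ (hfi k) (L1.integrable_coeFn f0)
    have e5 := norm_add_le (τ A - ∫ x in A, f k x ∂μ) (∫ x in A, f k x ∂μ - ∫ x in A, f0 x ∂μ)
    rw [sub_add_sub_cancel] at e5
    have e6 := e2.trans e3
    linarith
  have h0 : Tendsto (fun k => (1/2 : ℝ) ^ k + ∫ x, ‖f k x - f0 x‖ ∂μ) atTop (𝓝 0) := by
    simpa using (tendsto_pow_atTop_nhds_zero_of_lt_one (by norm_num) (by norm_num : (1/2:ℝ) < 1)).add
      hlim
  have := ge_of_tendsto' h0 hb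
  exact sub_eq_zero.1 (norm_le_zero_iff.1 this)

/-! ### The Bourgain-Pisier construction, abstract version -/

lemma exists_norming_quot {A : Type*} [SeminormedAddCommGroup A] [NormedSpace ℝ A]
    (R F : Submodule ℝ A) [FiniteDimensional ℝ F] (κ : ℝ) (hκ : κ < 1) (n : ℕ) :
    ∃ (N : ℕ) (θ : A →ₗ[ℝ] (Fin N → ℝ)), n ≤ N ∧ (∀ a, ‖θ a‖ ≤ dS R a) ∧
      ∀ f ∈ F, κ * dS R f ≤ ‖θ f‖ := by
  let π : A →ₗ[ℝ] SeparationQuotient (A ⧸ R) :=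
    (SeparationQuotient.mkCLM ℝ (A ⧸ R)).toLinearMap ∘ₗ R.mkQ
  have hπ : ∀ a, ‖π a‖ = dS R a := fun a => SeparationQuotient.norm_mk _
  obtain ⟨N, θ, h1, h2⟩ := exists_norming (F.map π) κ hκ
  let θ' : A →ₗ[ℝ] (Fin (N + n) → ℝ) := LinearMap.pi fun j =>
    Fin.addCases (motive := fun _ => A →ₗ[ℝ] ℝ)
      (fun i => (LinearMap.proj i) ∘ₗ θ.toLinearMap ∘ₗ π) (fun _ => 0) j
  have hl : ∀ a i, θ' a (Fin.castAdd n i) = θ (π a) i := fun a i => by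
    simp [θ']
  have hr : ∀ a i, θ' a (Fin.natAdd N i) = 0 := fun a i => by
    simp [θ']
  refine ⟨N + n, θ', by omega, fun a => ?_, fun f hf => ?_⟩
  · rw [pi_norm_le_iff_of_nonneg (dS_nonneg _ _)]
    intro j
    refine Fin.addCases (fun i => ?_) (fun i => ?_) j
    · rw [hl, ← hπ]
      exact (norm_le_pi_norm _ i).trans (h1 _)
    · rw [hr, norm_zero]; exact dS_nonneg _ _
  · rw [← hπ]
    refine (h2 (π f) (Submodule.mem_map_of_mem hf)).trans ?_
    rw [pi_norm_le_iff_of_nonneg (norm_nonneg _)]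
    intro i
    rw [← hl]
    exact norm_le_pi_norm _ _

/-- Index set of the generators. -/
abbrev GenIx : Type := ℕ ⊕ ℕ × ℕ

/-- Level of a generator. -/
def lev : GenIx → ℕ
  | Sum.inl _ => 0
  | Sum.inr p => p.1 + 1

/-- The embedding of `ℓ∞^N` on the `n`-th block. -/
noncomputable def blk {A : Type*} [AddCommGroup A] [Module ℝ A] (e : GenIx → A) (n N : ℕ) :
    (Fin N → ℝ) →ₗ[ℝ] A := Fintype.linearCombination ℝ (fun j : Fin N => e (Sum.inr (n, (j : ℕ))))

lemma blk_apply {A : Type*} [AddCommGroup A] [Module ℝ A] (e : GenIx → A) (n N : ℕ)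
    (a : Fin N → ℝ) : blk e n N a = ∑ j, a j • e (Sum.inr (n, (j : ℕ))) := rfl

theorem bp_abstract {A : Type*} [SeminormedAddCommGroup A] [NormedSpace ℝ A]
    (P : ℕ → A →ₗ[ℝ] A) (e : GenIx → A)
    (hP : ∀ n a, ‖a‖ = ‖P n a‖ + ‖a - P n a‖)
    (hPP : ∀ n m a, P n (P m a) = P (min n m) a)
    (hPe : ∀ n i, P n (e i) = if lev i ≤ n then e i else 0)
    (hblk : ∀ n N (a : Fin N → ℝ), ‖blk e n N a‖ = ‖a‖)
    (hblk2 : ∀ n N (a : Fin N → ℝ), ∀ s ∈ Submodule.span ℝ {y | ∃ i, N ≤ i ∧ y = e (Sum.inr (n, i))},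
      ‖a‖ ≤ ‖blk e n N a + s‖)
    (lam : ℝ) (hlam : 1 < lam) :
    ∃ (R : Submodule ℝ A) (δ : ℝ), δ = 1 - 1 / Real.sqrt lam ∧
      (∀ w, P 0 w = w → dS R w = ‖w‖) ∧
      (∀ n, ∃ K, ∀ i, K ≤ i → dS R (e (Sum.inr (n, i))) = 0) ∧
      (∀ n m (z : Fin m → A) (y : A), P n y = y → ∀ ε : ℝ, 0 < ε →
        ∃ u : Fin m → A, (∀ i, P n (u i) = u i) ∧
        dS R (∑ i, z i) + δ * ∑ i, dS R (z i - u i) ≤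
          ∑ i, dS R (z i) + 2 * dS R (∑ i, z i - y) + ε) ∧
      (∀ m, ∃ n N, m ≤ N ∧
        (∀ a : Fin N → ℝ, lam⁻¹ * ‖a‖ ≤ dS R (blk e n N a) ∧ dS R (blk e n N a) ≤ ‖a‖) ∧
        ∀ i, Encodable.encode i < m → ∃ b : Fin N → ℝ, dS R (e i - blk e n N b) = 0) := by
  classical
  have hlam0 : 0 < lam := by linarith
  set η := 1 / Real.sqrt lam with hη
  have hsq : 1 < Real.sqrt lam := by
    rw [Real.lt_sqrt (by norm_num)]; simpa using hlam
  have hη0 : 0 < η := by positivity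
  have hη1 : η < 1 := by rw [hη, div_lt_one (by positivity)]; exact hsq
  have hηlam : η * (η * lam) = 1 := by
    rw [hη]; field_simp; rw [Real.sq_sqrt hlam0.le]
  let F : ℕ → Submodule ℝ A := fun n =>
    Submodule.span ℝ (e '' {i | Encodable.encode i < n ∧ lev i ≤ n})
  have hFfin : ∀ n, FiniteDimensional ℝ (F n) := fun n => by
    refine FiniteDimensional.span_of_finite ℝ (Set.Finite.image _ ?_)
    refine Set.Finite.subset (Set.Finite.preimage (f := fun i : GenIx => Encodable.encode i)
      (Encodable.encode_injective.injOn) (Set.finite_lt_nat n)) fun i hi => hi.1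
  choose Nf θf hNn hθ1 hθ2 using fun (n : ℕ) (R : Submodule ℝ A) =>
    exists_norming_quot R (F n) η hη1 n
  let tail : ℕ → ℕ → Submodule ℝ A := fun n N =>
    Submodule.span ℝ {y | ∃ i, N ≤ i ∧ y = e (Sum.inr (n, i))}
  let rel : ∀ (n : ℕ) (R : Submodule ℝ A), A →ₗ[ℝ] A := fun n R =>
    (blk e n (Nf n R)) ∘ₗ (lam • θf n R) - LinearMap.id
  let step : ℕ → Submodule ℝ A → Submodule ℝ A := fun n R =>
    R ⊔ ((F n).map (rel n R) ⊔ tail n (Nf n R))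
  let Rn : ℕ → Submodule ℝ A := fun n => Nat.rec ⊥ (fun n R => step n R) n
  have hR0 : Rn 0 = ⊥ := rfl
  have hRs : ∀ n, Rn (n+1) = step n (Rn n) := fun n => rfl
  let Nn : ℕ → ℕ := fun n => Nf n (Rn n)
  let θ : ∀ n, A →ₗ[ℝ] (Fin (Nn n) → ℝ) := fun n => θf n (Rn n)
  have hmono : Monotone Rn := monotone_nat_of_le_succ fun n => by
    rw [hRs]; exact le_sup_left
  -- decomposition of elements of `Rn (n+1)`
  have hdec : ∀ n, ∀ r ∈ Rn (n+1), ∃ r0 ∈ Rn n, ∃ f ∈ F n, ∃ s ∈ tail n (Nn n),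
      r = r0 + (blk e n (Nn n) (lam • θ n f) - f) + s := by
    intro n r hr
    rw [hRs] at hr
    obtain ⟨r0, hr0, t, ht, rfl⟩ := Submodule.mem_sup.1 hr
    obtain ⟨t1, ht1, s, hs, rfl⟩ := Submodule.mem_sup.1 ht
    obtain ⟨f, hf, rfl⟩ := Submodule.mem_map.1 ht1
    refine ⟨r0, hr0, f, hf, s, hs, ?_⟩
    rw [add_assoc]
    rfl
  have hPblk : ∀ n k N a, P k (blk e n N a) = if n + 1 ≤ k then blk e n N a else 0 := by
    intro n k N a
    rw [blk_apply, map_sum]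
    split_ifs with h
    · refine Finset.sum_congr rfl fun j _ => ?_
      rw [map_smul, hPe, if_pos]; exact h
    · refine Finset.sum_eq_zero fun j _ => ?_
      rw [map_smul, hPe, if_neg, smul_zero]; exact h
  have hPtail : ∀ n k N, ∀ s ∈ tail n N, P k s = if n + 1 ≤ k then s else 0 := by
    intro n k N s hs
    split_ifs with h
    · have : tail n N ≤ LinearMap.eqLocus (P k) LinearMap.id := by
        refine Submodule.span_le.2 ?_
        rintro _ ⟨i, -, rfl⟩
        change P k _ = _
        rw [hPe, if_pos]; · rfl
        · exact h
      exact this hs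
    · have : tail n N ≤ LinearMap.ker (P k) := by
        refine Submodule.span_le.2 ?_
        rintro _ ⟨i, -, rfl⟩
        change P k _ = _
        rw [hPe, if_neg]; exact h
      exact this hs
  have hPF : ∀ n, ∀ f ∈ F n, P n f = f := by
    intro n f hf
    have : F n ≤ LinearMap.eqLocus (P n) LinearMap.id := by
      refine Submodule.span_le.2 ?_
      rintro _ ⟨i, hi, rfl⟩
      change P n _ = _
      rw [hPe, if_pos hi.2]; rfl
    exact this hf
  have hPmono : ∀ n m a, n ≤ m → P n a = a → P m a = a := by
    intro n m a hnm h
    rw [← h, hPP, min_eq_right hnm]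
  have hPR : ∀ n, ∀ r ∈ Rn n, P n r = r := by
    intro n
    induction n with
    | zero => intro r hr; rw [hR0, Submodule.mem_bot] at hr; rw [hr, map_zero]
    | succ n ih =>
      intro r hr
      obtain ⟨r0, hr0, f, hf, s, hs, rfl⟩ := hdec n r hr
      rw [map_add, map_add, map_sub, hPblk, if_pos le_rfl, hPtail n _ _ s hs, if_pos le_rfl,
        hPmono n (n+1) r0 (by omega) (ih r0 hr0), hPmono n (n+1) f (by omega) (hPF n f hf)]
  have hPle : ∀ n a, ‖P n a‖ ≤ ‖a‖ := fun n a => by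
    rw [hP n a]; linarith [norm_nonneg (a - P n a)]
  have hTle : ∀ n a, ‖a - P n a‖ ≤ ‖a‖ := fun n a => by
    have := hP n a; linarith [norm_nonneg (P n a)]
  -- base estimate
  have hbase : ∀ n, ∀ r ∈ Rn (n+1), dS (Rn n) (P n r) ≤ η * ‖r - P n r‖ := by
    intro n r hr
    obtain ⟨r0, hr0, f, hf, s, hs, rfl⟩ := hdec n r hr
    have e1 : P n (r0 + (blk e n (Nn n) (lam • θ n f) - f) + s) = r0 - f := by
      rw [map_add, map_add, map_sub, hPblk, if_neg (by omega), hPtail n _ _ s hs,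
        if_neg (by omega), hPR n r0 hr0, hPF n f hf]
      abel
    rw [e1]
    have e2 : r0 + (blk e n (Nn n) (lam • θ n f) - f) + s - (r0 - f) =
      blk e n (Nn n) (lam • θ n f) + s := by abel
    rw [e2]
    have h1 : dS (Rn n) (r0 - f) = dS (Rn n) f := by
      rw [← dS_neg, neg_sub, dS_sub_mem _ _ hr0]
    have h2 := hblk2 n (Nn n) (lam • θ n f) s hs
    rw [norm_smul, Real.norm_eq_abs, abs_of_pos hlam0] at h2
    have h3 := hθ2 n (Rn n) f hf
    change η * dS (Rn n) f ≤ ‖θ n f‖ at h3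
    rw [h1]
    calc dS (Rn n) f = η * lam * (η * dS (Rn n) f) := by linear_combination (-(dS (Rn n) f)) * hηlam
      _ ≤ η * lam * ‖θ n f‖ := by gcongr
      _ = η * (lam * ‖θ n f‖) := by ring
      _ ≤ _ := by gcongr
  -- the main estimate
  have hmain : ∀ m n, ∀ r ∈ Rn m, dS (Rn n) (P n r) ≤ η * ‖r - P n r‖ := by
    intro m
    induction m with
    | zero =>
      intro n r hr
      rw [hR0, Submodule.mem_bot] at hr
      rw [hr, map_zero, dS_zero]; positivity
    | succ k ih =>
      intro n r hr
      by_cases hnk : k + 1 ≤ n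
      · rw [hPmono (k+1) n r hnk (hPR _ r hr), dS_mem _ (hmono hnk hr)]
        positivity
      · have hnk' : n ≤ k := by omega
        refine le_of_forall_pos_le_add fun ε hε => ?_
        obtain ⟨r', hr', hlt⟩ := exists_dS_lt (Rn k) (P k r) hε
        have hb := hbase k r hr
        set w := P k r with hw
        have hPnr : P n r = P n w := by rw [hw, hPP, min_eq_left hnk']
        have i1 : dS (Rn n) (P n r) ≤ ‖P n (w - r')‖ + dS (Rn n) (P n r') := by
          have : P n r = P n (w - r') + P n r' := by rw [hPnr, map_sub]; abel
          rw [this]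
          refine (dS_add _ _ _).trans ?_
          linarith [dS_le_norm (Rn n) (P n (w - r'))]
        have i2 := ih n r' hr'
        have i3 : ‖r' - P n r'‖ ≤ ‖(w - r') - P n (w - r')‖ + ‖w - P n w‖ := by
          have : r' - P n r' = (w - P n w) - ((w - r') - P n (w - r')) := by rw [map_sub]; abel
          rw [this]
          linarith [norm_sub_le (w - P n w) ((w - r') - P n (w - r'))]
        have i4 := hP n (w - r')
        have i5 : ‖r - P n r‖ = ‖w - P n w‖ + ‖r - w‖ := by
          rw [hP k (r - P n r), map_sub, hPP, min_eq_right hnk', ← hw, hPnr]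
          congr 1
          congr 1
          abel
        have i6 := norm_nonneg ((w - r') - P n (w - r'))
        rw [i5]
        have i7 := mul_le_mul_of_nonneg_left i3 hη0.le
        have i8 : η * ‖(w - r') - P n (w - r')‖ ≤ ‖(w - r') - P n (w - r')‖ := by nlinarith
        nlinarith
  let R : Submodule ℝ A := ⨆ n, Rn n
  have hmemR : ∀ r, r ∈ R ↔ ∃ n, r ∈ Rn n := fun r =>
    Submodule.mem_iSup_of_directed Rn hmono.directed_le
  have hRle : ∀ n, Rn n ≤ R := fun n => le_iSup Rn n
  have hmainR : ∀ n, ∀ r ∈ R, dS (Rn n) (P n r) ≤ η * ‖r - P n r‖ := by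
    intro n r hr
    obtain ⟨m, hm⟩ := (hmemR r).1 hr
    exact hmain m n r hm
  have hdR : ∀ n w, P n w = w → dS R w = dS (Rn n) w := by
    intro n w hw
    refine le_antisymm (dS_anti (hRle n) w) ?_
    refine le_dS _ _ _ fun r hr => ?_
    have h1 := hP n (w - r)
    rw [map_sub, hw] at h1
    have h2 : ‖w - r - (w - P n r)‖ = ‖r - P n r‖ := by
      rw [← norm_neg]; congr 1; abel
    have h3 := hmainR n r hr
    have h4 := dS_add (Rn n) (w - P n r) (P n r)
    rw [sub_add_cancel] at h4
    have h5 := dS_le_norm (Rn n) (w - P n r)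
    have h6 : η * ‖r - P n r‖ ≤ ‖r - P n r‖ := by nlinarith [norm_nonneg (r - P n r)]
    linarith
  refine ⟨R, 1 - η, rfl, ?_, ?_, ?_, ?_⟩
  · intro w hw
    rw [hdR 0 w hw]
    refine le_antisymm (dS_le_norm _ _) (le_dS _ _ _ fun r hr => ?_)
    rw [hR0, Submodule.mem_bot] at hr
    rw [hr, sub_zero]
  · intro n
    refine ⟨Nn n, fun i hi => dS_mem _ (hRle (n+1) ?_)⟩
    rw [hRs]
    exact Submodule.mem_sup_right (Submodule.mem_sup_right (Submodule.subset_span ⟨i, hi, rfl⟩))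
  · intro n m z y hy ε hε
    set e' := ε / (m + 1) with he'
    have he0 : 0 < e' := by positivity
    choose r hr hrlt using fun i => exists_dS_lt R (z i) he0
    refine ⟨fun i => P n (z i - r i), fun i => by rw [hPP, min_self], ?_⟩
    set Y := ∑ i, (z i - r i) with hY
    have hrs : ∑ i, r i ∈ R := Submodule.sum_mem _ fun i _ => hr i
    have hYz : Y = ∑ i, z i - ∑ i, r i := by rw [hY, Finset.sum_sub_distrib]
    have hNY : dS R Y = dS R (∑ i, z i) := by rw [hYz, dS_sub_mem _ _ hrs]
    have hNYy : dS R (Y - y) = dS R (∑ i, z i - y) := by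
      rw [hYz, sub_right_comm, dS_sub_mem _ _ hrs]
    rw [← hNY, ← hNYy]
    have k1 : ∀ i, dS R (z i - P n (z i - r i)) ≤ ‖(z i - r i) - P n (z i - r i)‖ := by
      intro i
      rw [← dS_sub_mem R _ (hr i), sub_right_comm]
      exact dS_le_norm _ _
    have k2 : ‖P n Y‖ ≤ ∑ i, ‖P n (z i - r i)‖ := by
      rw [hY, map_sum]; exact norm_sum_le _ _
    have k3 : ‖Y - P n Y‖ ≤ ∑ i, ‖(z i - r i) - P n (z i - r i)‖ := by
      rw [hY, map_sum, ← Finset.sum_sub_distrib]; exact norm_sum_le _ _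
    have k4 : ∑ i, ‖P n (z i - r i)‖ + ∑ i, ‖(z i - r i) - P n (z i - r i)‖ ≤
        ∑ i, dS R (z i) + m * e' := by
      rw [← Finset.sum_add_distrib]
      calc _ ≤ ∑ i, (dS R (z i) + e') := Finset.sum_le_sum fun i _ => by
            rw [← hP]; exact (hrlt i).le
        _ = _ := by
          rw [Finset.sum_add_distrib, Finset.sum_const, nsmul_eq_mul, Finset.card_univ,
            Fintype.card_fin]
    have k5 : dS R Y ≤ ‖P n Y‖ + η * ‖Y - P n Y‖ + 2 * dS R (Y - y) + e' := by
      obtain ⟨ρ, hρ, hρlt⟩ := exists_dS_lt R (Y - y) he0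
      have l1 := hP n (Y - y - ρ)
      have l2 := hmainR n ρ hρ
      have l3 : ‖ρ - P n ρ‖ ≤ ‖Y - P n Y‖ + ‖(Y - y - ρ) - P n (Y - y - ρ)‖ := by
        have : ρ - P n ρ = (Y - P n Y) - ((Y - y - ρ) - P n (Y - y - ρ)) := by
          rw [map_sub, map_sub, hy]; abel
        rw [this]; exact norm_sub_le _ _
      have l4 : dS R y ≤ ‖P n Y‖ + ‖P n (Y - y - ρ)‖ + dS (Rn n) (P n ρ) := by
        have : y = P n Y - P n (Y - y - ρ) - P n ρ := by
          rw [map_sub, map_sub, hy]; abel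
        have h7 := dS_sub R (P n Y - P n (Y - y - ρ)) (P n ρ)
        rw [← this] at h7
        have h8 := dS_sub R (P n Y) (P n (Y - y - ρ))
        have h9 := dS_le_norm R (P n Y)
        have h10 := dS_le_norm R (P n (Y - y - ρ))
        have h11 := dS_anti (hRle n) (P n ρ)
        linarith
      have l5 : dS R Y ≤ dS R y + dS R (Y - y) := by
        have := dS_add R y (Y - y)
        rwa [add_sub_cancel] at this
      have l6 := mul_le_mul_of_nonneg_left l3 hη0.le
      have l7 : η * ‖(Y - y - ρ) - P n (Y - y - ρ)‖ ≤ ‖(Y - y - ρ) - P n (Y - y - ρ)‖ := by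
        nlinarith [norm_nonneg ((Y - y - ρ) - P n (Y - y - ρ))]
      linarith
    have k6 : ∑ i, dS R (z i - P n (z i - r i)) ≤ ∑ i, ‖(z i - r i) - P n (z i - r i)‖ :=
      Finset.sum_le_sum fun i _ => k1 i
    have k7 : (m + 1) * e' = ε := by rw [he']; field_simp
    have k8 := mul_le_mul_of_nonneg_left k6 (sub_nonneg.2 hη1.le)
    have k9 := mul_le_mul_of_nonneg_left k3 hη0.le
    linarith
  · intro m
    let n := m + ∑ i ∈ Finset.range m, (match (Encodable.decode (α := GenIx) i) with
      | some j => lev j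
      | none => 0)
    refine ⟨n, Nn n, le_trans (Nat.le_add_right _ _) (hNn n (Rn n)), fun a => ⟨?_, ?_⟩, ?_⟩
    · rw [hdR (n+1) _ (by rw [hPblk, if_pos le_rfl])]
      refine le_dS _ _ _ fun r hr => ?_
      obtain ⟨r0, hr0, f, hf, s, hs, rfl⟩ := hdec n r hr
      rw [hP n]
      have e1 : P n (blk e n (Nn n) a - (r0 + (blk e n (Nn n) (lam • θ n f) - f) + s)) = f - r0 := by
        rw [map_sub, map_add, map_add, map_sub, hPblk, hPblk, if_neg (by omega),
          if_neg (by omega), hPtail n _ _ s hs,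
          if_neg (by omega), hPR n r0 hr0, hPF n f hf]
        abel
      have e2 : blk e n (Nn n) a - (r0 + (blk e n (Nn n) (lam • θ n f) - f) + s) - (f - r0) =
          blk e n (Nn n) (a - lam • θ n f) + (-s) := by
        rw [map_sub]; abel
      rw [e1, e2]
      have h1 := hblk2 n (Nn n) (a - lam • θ n f) (-s) (Submodule.neg_mem _ hs)
      have h2 := hθ1 n (Rn n) f
      change ‖θ n f‖ ≤ _ at h2
      have h3 := dS_le (Rn n) f hr0
      have h4 : ‖a‖ ≤ ‖a - lam • θ n f‖ + lam * ‖θ n f‖ := by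
        have := norm_add_le (a - lam • θ n f) (lam • θ n f)
        rwa [sub_add_cancel, norm_smul, Real.norm_eq_abs, abs_of_pos hlam0] at this
      have h5 : lam⁻¹ * ‖a‖ ≤ lam⁻¹ * ‖a - lam • θ n f‖ + ‖θ n f‖ := by
        have := mul_le_mul_of_nonneg_left h4 (inv_nonneg.2 hlam0.le)
        rwa [mul_add, inv_mul_cancel_left₀ hlam0.ne'] at this
      have h6 : lam⁻¹ * ‖a - lam • θ n f‖ ≤ ‖a - lam • θ n f‖ :=
        mul_le_of_le_one_left (norm_nonneg _) (inv_le_one_of_one_le₀ hlam.le)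
      linarith
    · exact (dS_le_norm _ _).trans (hblk n _ a).le
    · intro i hi
      refine ⟨lam • θ n (e i), dS_mem _ (hRle (n+1) ?_)⟩
      rw [hRs]
      refine Submodule.mem_sup_right (Submodule.mem_sup_left ?_)
      refine ⟨-(e i), Submodule.neg_mem _ (Submodule.subset_span ⟨i, ⟨?_, ?_⟩, rfl⟩), ?_⟩
      · exact hi.trans_le (Nat.le_add_right _ _)
      · have := Finset.single_le_sum (f := fun i => (match (Encodable.decode (α := GenIx) i) with
          | some j => lev j
          | none => 0)) (fun _ _ => Nat.zero_le _) (Finset.mem_range.2 hi)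
        simp only [Encodable.encodek] at this
        exact this.trans (Nat.le_add_left _ _)
      · change blk e n (Nn n) (lam • θ n (-(e i))) - -(e i) = _
        rw [map_neg, smul_neg, map_neg]; abel

/-! ### The Bourgain-Pisier construction, concrete version -/

/-- Sup norm on the `n`-th block. -/
noncomputable def blkSup (n : ℕ) (a : GenIx →₀ ℝ) : ℝ := ⨆ i : ℕ, |a (Sum.inr (n, i))|

lemma blkSup_bdd (n : ℕ) (a : GenIx →₀ ℝ) :
    BddAbove (Set.range fun i : ℕ => |a (Sum.inr (n, i))|) := by
  refine ⟨∑ j ∈ a.support, |a j|, ?_⟩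
  rintro _ ⟨i, rfl⟩
  dsimp only
  by_cases h : Sum.inr (n, i) ∈ a.support
  · exact Finset.single_le_sum (f := fun j => |a j|) (fun _ _ => abs_nonneg _) h
  · rw [Finsupp.notMem_support_iff.1 h, abs_zero]
    exact Finset.sum_nonneg fun _ _ => abs_nonneg _

lemma le_blkSup (n i : ℕ) (a : GenIx →₀ ℝ) : |a (Sum.inr (n, i))| ≤ blkSup n a :=
  le_ciSup (blkSup_bdd n a) i

lemma blkSup_le (n : ℕ) (a : GenIx →₀ ℝ) (c : ℝ) (h : ∀ i, |a (Sum.inr (n, i))| ≤ c) :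
    blkSup n a ≤ c := ciSup_le h

lemma blkSup_nonneg (n : ℕ) (a : GenIx →₀ ℝ) : 0 ≤ blkSup n a :=
  (abs_nonneg _).trans (le_blkSup n 0 a)

lemma blkSup_add (n : ℕ) (a b : GenIx →₀ ℝ) : blkSup n (a + b) ≤ blkSup n a + blkSup n b :=
  blkSup_le _ _ _ fun i => (abs_add_le _ _).trans (add_le_add (le_blkSup n i a) (le_blkSup n i b))

lemma blkSup_smul (n : ℕ) (c : ℝ) (a : GenIx →₀ ℝ) : blkSup n (c • a) = |c| * blkSup n a := by
  unfold blkSup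
  rw [Real.mul_iSup_of_nonneg (abs_nonneg c)]
  simp [abs_mul]

lemma blkSup_eq_zero (n : ℕ) (a : GenIx →₀ ℝ) (h : ∀ i, a (Sum.inr (n, i)) = 0) :
    blkSup n a = 0 :=
  le_antisymm (blkSup_le _ _ _ fun i => by rw [h, abs_zero]) (blkSup_nonneg _ _)

lemma blkSup_summable (a : GenIx →₀ ℝ) : Summable fun n => blkSup n a := by
  classical
  refine summable_of_ne_finset_zero (s := a.support.image lev |>.image Nat.pred) fun n hn => ?_
  refine blkSup_eq_zero n a fun i => ?_
  by_contra h
  refine hn ?_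
  refine Finset.mem_image.2 ⟨n + 1, Finset.mem_image.2 ⟨Sum.inr (n, i), ?_, rfl⟩, rfl⟩
  exact Finsupp.mem_support_iff.2 h

/-- The `ℓ₁`-sum norm on the generators. -/
noncomputable def baseNorm {X : Type*} [SeminormedAddCommGroup X] [NormedSpace ℝ X] (x : ℕ → X)
    (a : GenIx →₀ ℝ) : ℝ :=
  ‖Finsupp.linearCombination ℝ (Sum.elim x (fun _ => 0)) a‖ + ∑' n, blkSup n a

/-- Projection on the generators of level at most `n`. -/
noncomputable def levProj (n : ℕ) : (GenIx →₀ ℝ) →ₗ[ℝ] (GenIx →₀ ℝ) where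
  toFun a := a.filter fun i => lev i ≤ n
  map_add' a b := Finsupp.filter_add
  map_smul' c a := Finsupp.filter_smul

lemma levProj_apply (n : ℕ) (a : GenIx →₀ ℝ) (i : GenIx) :
    levProj n a i = if lev i ≤ n then a i else 0 := by
  classical
  simp [levProj, Finsupp.filter_apply]

lemma levProj_eq_self_iff (n : ℕ) (a : GenIx →₀ ℝ) :
    levProj n a = a ↔ ∀ i, n < lev i → a i = 0 := by
  constructor
  · intro h i hi
    rw [← h, levProj_apply, if_neg (by omega)]
  · intro h
    ext i
    rw [levProj_apply]
    split_ifs with hi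
    · rfl
    · rw [h i (by omega)]

/-- Generator. -/
noncomputable def gen (i : GenIx) : GenIx →₀ ℝ := Finsupp.single i 1

lemma blk_gen_apply (n N : ℕ) (a : Fin N → ℝ) (j : Fin N) :
    blk gen n N a (Sum.inr (n, (j : ℕ))) = a j := by
  classical
  rw [blk_apply, Finsupp.finset_sum_apply, Finset.sum_eq_single j]
  · simp [gen]
  · intro i _ hij
    simp [gen, Finsupp.single_apply, Fin.val_inj, hij]
  · simp

lemma blk_gen_apply_ne (n N : ℕ) (a : Fin N → ℝ) (i : GenIx)
    (h : ∀ j : Fin N, Sum.inr (n, (j : ℕ)) ≠ i) : blk gen n N a i = 0 := by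
  classical
  rw [blk_apply, Finsupp.finset_sum_apply]
  refine Finset.sum_eq_zero fun j _ => ?_
  simp [gen, Finsupp.single_apply, h j]

theorem bp_seminorm {X : Type*} [SeminormedAddCommGroup X] [NormedSpace ℝ X] (x : ℕ → X)
    (lam : ℝ) (hlam : 1 < lam) :
    ∃ p : Seminorm ℝ (GenIx →₀ ℝ),
      (∀ q : ℕ →₀ ℝ, p (q.mapDomain Sum.inl) = ‖Finsupp.linearCombination ℝ x q‖) ∧
      (∀ n, ∃ K, ∀ i, K ≤ i → p (gen (Sum.inr (n, i))) = 0) ∧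
      (∀ n m (z : Fin m → (GenIx →₀ ℝ)) (y : GenIx →₀ ℝ), levProj n y = y → ∀ ε : ℝ, 0 < ε →
        ∃ u : Fin m → (GenIx →₀ ℝ), (∀ i, levProj n (u i) = u i) ∧
        p (∑ i, z i) + (1 - 1 / Real.sqrt lam) * ∑ i, p (z i - u i) ≤
          ∑ i, p (z i) + 2 * p (∑ i, z i - y) + ε) ∧
      (∀ m, ∃ n N, m ≤ N ∧
        (∀ a : Fin N → ℝ, lam⁻¹ * ‖a‖ ≤ p (blk gen n N a) ∧ p (blk gen n N a) ≤ ‖a‖) ∧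
        ∀ i, Encodable.encode i < m → ∃ b : Fin N → ℝ, p (gen i - blk gen n N b) = 0) := by
  classical
  letI nI : Norm (GenIx →₀ ℝ) := ⟨baseNorm x⟩
  have hnorm : ∀ a : GenIx →₀ ℝ, ‖a‖ = baseNorm x a := fun _ => rfl
  have hcore : SeminormedSpace.Core ℝ (GenIx →₀ ℝ) :=
    { norm_nonneg := fun a => add_nonneg (norm_nonneg _) (tsum_nonneg fun n => blkSup_nonneg n a)
      norm_smul := fun c a => by
        simp only [hnorm, baseNorm, map_smul, norm_smul, blkSup_smul, tsum_mul_left,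
          Real.norm_eq_abs]
        ring
      norm_triangle := fun a b => by
        simp only [hnorm, baseNorm, map_add]
        have h1 := norm_add_le (Finsupp.linearCombination ℝ (Sum.elim x (fun _ => 0)) a)
          (Finsupp.linearCombination ℝ (Sum.elim x (fun _ => 0)) b)
        have h2 : ∑' n, blkSup n (a + b) ≤ ∑' n, (blkSup n a + blkSup n b) :=
          Summable.tsum_le_tsum (fun n => blkSup_add n a b) (blkSup_summable _)
            ((blkSup_summable a).add (blkSup_summable b))
        rw [(blkSup_summable a).tsum_add (blkSup_summable b)] at h2
        linarith }
  letI sI : SeminormedAddCommGroup (GenIx →₀ ℝ) := SeminormedAddCommGroup.ofCore hcore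
  letI nsI : NormedSpace ℝ (GenIx →₀ ℝ) := { norm_smul_le := fun c a => (hcore.norm_smul c a).le }
  have hcoef : ∀ (a : GenIx →₀ ℝ) n i, |a (Sum.inr (n, i))| ≤ ‖a‖ := by
    intro a n i
    rw [hnorm]
    have h1 : blkSup n a ≤ ∑' n, blkSup n a :=
      (blkSup_summable a).le_tsum n fun k _ => blkSup_nonneg k a
    have h2 := le_blkSup n i a
    have h3 := norm_nonneg (Finsupp.linearCombination ℝ (Sum.elim x (fun _ => 0)) a)
    unfold baseNorm
    linarith
  have hlc0 : ∀ a : GenIx →₀ ℝ, (∀ i, a (Sum.inl i) = 0) →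
      Finsupp.linearCombination ℝ (Sum.elim x (fun _ => (0 : X))) a = 0 := by
    intro a h
    rw [Finsupp.linearCombination_apply, Finsupp.sum]
    refine Finset.sum_eq_zero fun i _ => ?_
    rcases i with i | i
    · rw [h, zero_smul]
    · simp
  have hP : ∀ n (a : GenIx →₀ ℝ), ‖a‖ = ‖levProj n a‖ + ‖a - levProj n a‖ := by
    -- splitting of the norm
    intro n a
    simp only [hnorm, baseNorm]
    have h1 : Finsupp.linearCombination ℝ (Sum.elim x (fun _ => (0 : X))) (a - levProj n a) = 0 := by
      refine hlc0 _ fun i => ?_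
      rw [Finsupp.sub_apply, levProj_apply, if_pos (show lev (Sum.inl i) ≤ n from Nat.zero_le _), sub_self]
    have h2 : Finsupp.linearCombination ℝ (Sum.elim x (fun _ => (0 : X))) a =
        Finsupp.linearCombination ℝ (Sum.elim x (fun _ => (0 : X))) (levProj n a) := by
      rw [map_sub, sub_eq_zero] at h1; exact h1
    have h3 : ∀ k, blkSup k a = blkSup k (levProj n a) + blkSup k (a - levProj n a) := by
      intro k
      by_cases hk : k + 1 ≤ n
      · have e1 : ∀ i, levProj n a (Sum.inr (k, i)) = a (Sum.inr (k, i)) := fun i => by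
          rw [levProj_apply, if_pos (show lev (Sum.inr (k, i)) ≤ n from hk)]
        rw [blkSup_eq_zero k (a - levProj n a) (fun i => by rw [Finsupp.sub_apply, e1, sub_self]),
          add_zero]
        simp only [blkSup, e1]
      · have e1 : ∀ i, levProj n a (Sum.inr (k, i)) = 0 := fun i => by
          rw [levProj_apply, if_neg (show ¬ lev (Sum.inr (k, i)) ≤ n from hk)]
        rw [blkSup_eq_zero k (levProj n a) e1, zero_add]
        simp only [blkSup, Finsupp.sub_apply, e1, sub_zero]
    rw [h1, h2, norm_zero, zero_add, tsum_congr h3, (blkSup_summable _).tsum_add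
      (blkSup_summable _), add_assoc]
  have hPP : ∀ n m a, levProj n (levProj m a) = levProj (min n m) a := by
    intro n m a
    ext i
    simp only [levProj_apply, le_min_iff]
    split_ifs <;> simp_all
  have hPe : ∀ n i, levProj n (gen i) = if lev i ≤ n then gen i else 0 := by
    intro n i
    ext j
    rw [levProj_apply]
    by_cases hij : i = j
    · subst hij
      split_ifs <;> simp
    · split_ifs <;> simp [gen, Finsupp.single_apply, hij]
  have hblk : ∀ n N (a : Fin N → ℝ), ‖blk gen n N a‖ = ‖a‖ := by
    intro n N a
    refine le_antisymm ?_ ?_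
    · rw [hnorm, baseNorm, hlc0 _ (fun i => blk_gen_apply_ne _ _ _ _ (by simp)), norm_zero, zero_add,
        tsum_eq_single n]
      · refine blkSup_le _ _ _ fun i => ?_
        by_cases hi : i < N
        · have := blk_gen_apply n N a ⟨i, hi⟩
          simp only at this
          rw [this]
          exact norm_le_pi_norm a ⟨i, hi⟩
        · rw [blk_gen_apply_ne, abs_zero]
          · exact norm_nonneg a
          · intro j hj
            simp at hj
            omega
      · intro k hk
        refine blkSup_eq_zero _ _ fun i => blk_gen_apply_ne _ _ _ _ fun j hj => ?_
        simp at hj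
        omega
    · rw [pi_norm_le_iff_of_nonneg (hcore.norm_nonneg _)]
      intro j
      rw [← blk_gen_apply n N a j]
      exact hcoef _ _ _
  have hblk2 : ∀ n N (a : Fin N → ℝ), ∀ s ∈ Submodule.span ℝ {y | ∃ i, N ≤ i ∧ y = gen (Sum.inr (n, i))},
      ‖a‖ ≤ ‖blk gen n N a + s‖ := by
    intro n N a s hs
    rw [pi_norm_le_iff_of_nonneg (hcore.norm_nonneg _)]
    intro j
    have hs0 : s (Sum.inr (n, (j : ℕ))) = 0 := by
      have : Submodule.span ℝ {y | ∃ i, N ≤ i ∧ y = gen (Sum.inr (n, i))} ≤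
          LinearMap.ker (Finsupp.lapply (R := ℝ) (Sum.inr (n, (j : ℕ)) : GenIx)) := by
        refine Submodule.span_le.2 ?_
        rintro _ ⟨i, hi, rfl⟩
        have hj := j.2
        have : i ≠ j := by omega
        simp [gen, Finsupp.single_apply, this]
      exact this hs
    have h1 := hcoef (blk gen n N a + s) n j
    rw [Finsupp.add_apply, blk_gen_apply, hs0, add_zero] at h1
    exact h1
  obtain ⟨R, δ, hδ, H1, H2, H3, H4⟩ := bp_abstract (A := GenIx →₀ ℝ) levProj gen hP hPP hPe hblk hblk2
    lam hlam
  · refine ⟨Seminorm.of (dS R) (fun a b => dS_add R a b) (fun c a => by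
      rw [dS_smul, Real.norm_eq_abs]), ?_, H2, ?_, H4⟩
    · intro q
      change dS R _ = _
      rw [H1]
      · rw [hnorm, baseNorm]
        have h1 : ∑' n, blkSup n (q.mapDomain Sum.inl) = 0 := by
          have : ∀ n, blkSup n (q.mapDomain Sum.inl) = 0 := fun n => blkSup_eq_zero _ _ fun i => by
            rw [Finsupp.mapDomain_notin_range]; simp
          simp [this]
        rw [h1, add_zero, Finsupp.linearCombination_mapDomain]
        rfl
      · rw [levProj_eq_self_iff]
        rintro (i | i) hi
        · exact absurd hi (Nat.not_lt_zero _)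
        · rw [Finsupp.mapDomain_notin_range]; simp
    · rw [hδ] at H3
      exact H3

/-! ### Banach-Mazur -/

theorem banach_mazur_seminorm {ι : Type} [Countable ι] (p : Seminorm ℝ (ι →₀ ℝ)) :
    ∃ v : ι → CantorC, ∀ q : ι →₀ ℝ, ‖Finsupp.linearCombination ℝ v q‖ = p q := by
  classical
  let K : Set (ι → ℝ) := {c | ∀ q : ι →₀ ℝ, |∑ i ∈ q.support, q i * c i| ≤ p q}
  have hKcl : IsClosed K := by
    have : K = ⋂ q : ι →₀ ℝ, {c : ι → ℝ | |∑ i ∈ q.support, q i * c i| ≤ p q} := by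
      ext c; simp [K]
    rw [this]
    refine isClosed_iInter fun q => isClosed_le ?_ continuous_const
    fun_prop
  have hKc : IsCompact K := by
    refine (isCompact_univ_pi (s := fun i : ι => Set.Icc (-(p (Finsupp.single i 1)))
      (p (Finsupp.single i 1))) fun i => isCompact_Icc).of_isClosed_subset hKcl ?_
    intro c hc i _
    have := hc (Finsupp.single i 1)
    rw [Finsupp.support_single i one_ne_zero] at this
    simpa [abs_le] using this
  have hK0 : (0 : ι → ℝ) ∈ K := fun q => by simp
  haveI : Nonempty K := ⟨⟨0, hK0⟩⟩
  haveI : CompactSpace K := isCompact_iff_compactSpace.1 hKc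
  letI : MetricSpace K := TopologicalSpace.metrizableSpaceMetric K
  obtain ⟨s, hs, hsurj⟩ := exists_nat_bool_continuous_surjective_of_compact K
  let v : ι → CantorC := fun i => ⟨fun ω => (s ω).1 i, (continuous_apply i).comp (continuous_subtype_val.comp hs)⟩
  have hval : ∀ (q : ι →₀ ℝ) ω, Finsupp.linearCombination ℝ v q ω =
      ∑ i ∈ q.support, q i * (s ω).1 i := by
    intro q ω
    rw [Finsupp.linearCombination_apply, Finsupp.sum, ContinuousMap.sum_apply]
    rfl
  refine ⟨v, fun q => le_antisymm ?_ ?_⟩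
  · rw [ContinuousMap.norm_le _ (apply_nonneg p q)]
    intro ω
    rw [hval, Real.norm_eq_abs]
    exact (s ω).2 q
  · -- Hahn-Banach
    obtain ⟨g, hg1, hg2⟩ : ∃ g : (ι →₀ ℝ) →ₗ[ℝ] ℝ, g q = p q ∧ ∀ y, |g y| ≤ p y := by
      by_cases hq : q = 0
      · exact ⟨0, by simp [hq], fun y => by simp⟩
      obtain ⟨g, hg, hgle⟩ := Module.Dual.exists_extension_of_le_seminorm_real (p := p)
        (LinearPMap.mkSpanSingleton q (p q) hq).domain
        (LinearPMap.mkSpanSingleton q (p q) hq).toFun (by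
          rintro ⟨x, hx⟩
          obtain ⟨r, rfl⟩ := Submodule.mem_span_singleton.1 hx
          have h1 : (LinearPMap.mkSpanSingleton q (p q) hq) ⟨r • q, hx⟩ = r • p q :=
            LinearPMap.mkSpanSingleton'_apply _ _ _ r hx
          refine (h1.trans_le ?_)
          simp only [smul_eq_mul, map_smul_eq_mul, Real.norm_eq_abs]
          exact mul_le_mul_of_nonneg_right (le_abs_self r) (apply_nonneg p q))
      refine ⟨g, ?_, hgle⟩
      have h2 := hg ⟨q, Submodule.mem_span_singleton_self q⟩
      refine h2.trans ?_
      exact LinearPMap.mkSpanSingleton_apply ℝ ℝ hq (p q)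
    let c : ι → ℝ := fun i => g (Finsupp.single i 1)
    have hgc : ∀ y : ι →₀ ℝ, g y = ∑ i ∈ y.support, y i * c i := by
      intro y
      conv_lhs => rw [← Finsupp.sum_single y, Finsupp.sum, map_sum]
      refine Finset.sum_congr rfl fun i _ => ?_
      have : Finsupp.single i (y i) = y i • Finsupp.single i (1 : ℝ) := by simp
      rw [this, map_smul, smul_eq_mul]
    obtain ⟨ω, hω⟩ := hsurj ⟨c, fun y => by rw [← hgc]; exact hg2 y⟩
    have h1 := ContinuousMap.norm_coe_le_norm (Finsupp.linearCombination ℝ v q) ω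
    rw [hval, hω, ← hgc, hg1, Real.norm_eq_abs, abs_of_nonneg (apply_nonneg p q)] at h1
    exact h1

/-! ### The coding set -/

/-- Rational combinations as real combinations. -/
noncomputable def qc {ι : Type*} (q : ι →₀ ℚ) : ι →₀ ℝ := q.mapRange (fun r : ℚ => (r : ℝ)) Rat.cast_zero

/-- The conditions on a pair of generating sequences. -/
def BPcond (lam : ℝ) {V W : Type*} [SeminormedAddCommGroup V] [NormedSpace ℝ V]
    [SeminormedAddCommGroup W] [NormedSpace ℝ W] (x : ℕ → V) (v : GenIx → W) : Prop :=
  (∀ q : ℕ →₀ ℝ, ‖Finsupp.linearCombination ℝ v (q.mapDomain Sum.inl)‖ =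
    ‖Finsupp.linearCombination ℝ x q‖) ∧
  (∀ n, ∃ K, ∀ i, K ≤ i → ‖v (Sum.inr (n, i))‖ = 0) ∧
  (∀ n m (z : Fin m → (GenIx →₀ ℚ)) (y : GenIx →₀ ℚ), levProj n (qc y) = qc y → ∀ k : ℕ,
    ∃ u : Fin m → (GenIx →₀ ℝ), (∀ i, levProj n (u i) = u i) ∧
      ‖Finsupp.linearCombination ℝ v (∑ i, qc (z i))‖ +
        (1 - 1 / Real.sqrt lam) * ∑ i, ‖Finsupp.linearCombination ℝ v (qc (z i) - u i)‖ <
      ∑ i, ‖Finsupp.linearCombination ℝ v (qc (z i))‖ +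
        2 * ‖Finsupp.linearCombination ℝ v (∑ i, qc (z i) - qc y)‖ + 1 / ((k : ℝ) + 1)) ∧
  (∀ m : ℕ, ∃ n N, m ≤ N ∧
    (∀ a : Fin N → ℝ, lam⁻¹ * ‖a‖ ≤ ‖blk v n N a‖ ∧ ‖blk v n N a‖ ≤ ‖a‖) ∧
    ∀ i, Encodable.encode i < m → ∃ b : Fin N → ℝ, ‖v i - blk v n N b‖ < 1 / ((m : ℝ) + 1))

lemma lc_gen {W : Type*} [AddCommGroup W] [Module ℝ W] (v : GenIx → W) (i : GenIx) :
    Finsupp.linearCombination ℝ v (gen i) = v i := by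
  simp [gen]

lemma lc_blk {W : Type*} [AddCommGroup W] [Module ℝ W] (v : GenIx → W) (n N : ℕ) (a : Fin N → ℝ) :
    Finsupp.linearCombination ℝ v (blk gen n N a) = blk v n N a := by
  simp only [blk_apply, map_sum, map_smul, lc_gen]

lemma exists_BPcond {X : Type*} [SeminormedAddCommGroup X] [NormedSpace ℝ X] (x : ℕ → X)
    (lam : ℝ) (hlam : 1 < lam) : ∃ v : GenIx → CantorC, BPcond lam x v := by
  obtain ⟨p, h1, h2, h3, h4⟩ := bp_seminorm x lam hlam
  obtain ⟨v, hv⟩ := banach_mazur_seminorm p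
  refine ⟨v, ?_, ?_, ?_, ?_⟩
  · intro q
    rw [hv, h1]
  · intro n
    obtain ⟨K, hK⟩ := h2 n
    exact ⟨K, fun i hi => by rw [← lc_gen v, hv, hK i hi]⟩
  · intro n m z y hy k
    have hk : (0 : ℝ) < 1 / ((k : ℝ) + 1) := by positivity
    obtain ⟨u, hu, hle⟩ := h3 n m (fun i => qc (z i)) (qc y) hy (1 / ((k : ℝ) + 1) / 2) (by linarith)
    refine ⟨u, hu, ?_⟩
    simp only [hv]
    linarith
  · intro m
    obtain ⟨n, N, hmN, ha, hi⟩ := h4 m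
    refine ⟨n, N, hmN, fun a => ?_, fun i him => ?_⟩
    · rw [← lc_blk, hv]
      exact ha a
    · obtain ⟨b, hb⟩ := hi i him
      refine ⟨b, ?_⟩
      rw [← lc_gen v, ← lc_blk, ← map_sub, hv, hb]
      positivity

lemma continuous_lc {ι T W : Type*} [TopologicalSpace T] [SeminormedAddCommGroup W] [NormedSpace ℝ W]
    (f : T → ι → W) (hf : ∀ i, Continuous fun t => f t i) (q : ι →₀ ℝ) :
    Continuous fun t => Finsupp.linearCombination ℝ (f t) q := by
  simp only [Finsupp.linearCombination_apply, Finsupp.sum]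
  exact continuous_finsetSum _ fun i _ => continuous_const.smul (hf i)

lemma continuous_blk {T W : Type*} [TopologicalSpace T] [SeminormedAddCommGroup W] [NormedSpace ℝ W]
    (f : T → GenIx → W) (hf : ∀ i, Continuous fun t => f t i) (n N : ℕ) (a : Fin N → ℝ) :
    Continuous fun t => blk (f t) n N a := by
  simp only [blk_apply]
  exact continuous_finsetSum _ fun i _ => continuous_const.smul (hf _)

theorem measurableSet_BPcond (lam : ℝ) {T V W : Type*} [SeminormedAddCommGroup V] [NormedSpace ℝ V]
    [SeminormedAddCommGroup W] [NormedSpace ℝ W] [TopologicalSpace T] [MeasurableSpace T]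
    [BorelSpace T] (x : T → ℕ → V) (v : T → GenIx → W) (hx : ∀ i, Continuous fun t => x t i)
    (hv : ∀ i, Continuous fun t => v t i) : MeasurableSet {t | BPcond lam (x t) (v t)} := by
  have hlc := continuous_lc v hv
  have hlx := continuous_lc x hx
  have hbl := continuous_blk v hv
  simp only [BPcond, Set.ofPred_and, Set.ofPred_forall, Set.ofPred_exists]
  refine MeasurableSet.inter ?_ (MeasurableSet.inter ?_ (MeasurableSet.inter ?_ ?_))
  · refine IsClosed.measurableSet ?_
    exact isClosed_iInter fun q => isClosed_eq (hlc _).norm (hlx _).norm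
  · refine MeasurableSet.iInter fun n => ?_
    refine MeasurableSet.iUnion fun K => IsClosed.measurableSet ?_
    exact isClosed_iInter fun i => isClosed_iInter fun _ => isClosed_eq (hv _).norm continuous_const
  · refine MeasurableSet.iInter fun n => ?_
    refine MeasurableSet.iInter fun m => ?_
    refine MeasurableSet.iInter fun z => ?_
    refine MeasurableSet.iInter fun y => ?_
    refine MeasurableSet.iInter fun hy => ?_
    refine MeasurableSet.iInter fun k => ?_
    refine IsOpen.measurableSet ?_
    refine isOpen_iUnion fun u => ?_
    refine IsOpen.inter (isOpen_iInter_of_finite fun i => isOpen_const) (isOpen_lt ?_ ?_)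
    · exact (hlc _).norm.add (continuous_const.mul (continuous_finsetSum _ fun i _ => (hlc _).norm))
    · exact ((continuous_finsetSum _ fun i _ => (hlc _).norm).add
        (continuous_const.mul (hlc _).norm)).add continuous_const
  · refine MeasurableSet.iInter fun m => ?_
    refine MeasurableSet.iUnion fun n => ?_
    refine MeasurableSet.iUnion fun N => ?_
    refine MeasurableSet.inter (MeasurableSet.const _) (MeasurableSet.inter ?_ ?_)
    · refine IsClosed.measurableSet ?_
      exact isClosed_iInter fun a => (isClosed_le continuous_const (hbl _ _ _).norm).inter
        (isClosed_le (hbl _ _ _).norm continuous_const)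
    · refine MeasurableSet.iInter fun i => ?_
      refine MeasurableSet.iInter fun hi => ?_
      refine IsOpen.measurableSet ?_
      exact isOpen_iUnion fun b => isOpen_lt ((hv _).sub (hbl _ _ _)).norm continuous_const

/-- Closed span of a family. -/
noncomputable def cspan {ι : Type*} (v : ι → CantorC) : SB :=
  ⟨(Submodule.span ℝ (Set.range v)).topologicalClosure, Submodule.isClosed_topologicalClosure _⟩

lemma measurable_cspan {ι T : Type*} [TopologicalSpace T] [MeasurableSpace T] [BorelSpace T]
    (f : T → ι → CantorC) (hf : ∀ i, Continuous fun t => f t i) :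
    Measurable fun t => cspan (f t) := by
  refine measurable_generateFrom ?_
  rintro _ ⟨U, hU, rfl⟩
  refine IsOpen.measurableSet ?_
  have : (fun t => cspan (f t)) ⁻¹' {Y : SB | ((Y.1 : Set CantorC) ∩ U).Nonempty} =
      ⋃ q : ι →₀ ℝ, {t | Finsupp.linearCombination ℝ (f t) q ∈ U} := by
    ext t
    simp only [Set.mem_preimage, Set.mem_ofPred_eq, Set.mem_iUnion]
    change (closure (Submodule.span ℝ (Set.range (f t)) : Set CantorC) ∩ U).Nonempty ↔ _
    rw [closure_inter_open_nonempty_iff hU]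
    constructor
    · rintro ⟨w, hw, hwU⟩
      obtain ⟨q, rfl⟩ := (Finsupp.mem_span_range_iff_exists_finsupp).1 hw
      exact ⟨q, hwU⟩
    · rintro ⟨q, hq⟩
      exact ⟨_, Finsupp.mem_span_range_iff_exists_finsupp.2 ⟨q, rfl⟩, hq⟩
  rw [this]
  exact isOpen_iUnion fun q => hU.preimage (continuous_lc f hf q)

/-- The set of pairs. -/
def BPset (lam : ℝ) : Set (SB × SB) :=
  {P | ∃ (x : ℕ → CantorC) (v : GenIx → CantorC), BPcond lam x v ∧ P = (cspan x, cspan v)}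

lemma isAnalytic_BPset (lam : ℝ) (hlam : 1 < lam) : IsAnalyticIn (BPset lam) := by
  let T := (ℕ → CantorC) × (GenIx → CantorC)
  letI : MeasurableSpace T := borel T
  haveI : BorelSpace T := ⟨rfl⟩
  have hm : MeasurableSet {t : T | BPcond lam t.1 t.2} :=
    measurableSet_BPcond lam (fun t : T => t.1) (fun t => t.2)
      (fun i => (continuous_apply i).comp continuous_fst)
      (fun i => (continuous_apply i).comp continuous_snd)
  haveI : PolishSpace CantorC := inferInstance
  haveI : PolishSpace T := inferInstanceAs (PolishSpace ((ℕ → CantorC) × (GenIx → CantorC)))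
  have ha := hm.analyticSet
  rw [AnalyticSet] at ha
  rcases ha with ha | ⟨g, hg, hgr⟩
  · exfalso
    obtain ⟨v, hv⟩ := exists_BPcond (fun _ : ℕ => (0 : CantorC)) lam hlam
    have : ((fun _ => 0, v) : T) ∈ {t : T | BPcond lam t.1 t.2} := hv
    rw [ha] at this
    exact this
  · refine ⟨fun s => (cspan (g s).1, cspan (g s).2), ?_, ?_⟩
    · refine Measurable.prodMk (measurable_cspan _ fun i => ?_) (measurable_cspan _ fun i => ?_)
      · exact (continuous_apply i).comp (continuous_fst.comp hg)
      · exact (continuous_apply i).comp (continuous_snd.comp hg)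
    · ext P
      constructor
      · rintro ⟨x, v, h, rfl⟩
        have : ((x, v) : T) ∈ Set.range g := by rw [hgr]; exact h
        obtain ⟨s, hs⟩ := this
        exact ⟨s, by simp only [hs]⟩
      · rintro ⟨s, rfl⟩
        have : g s ∈ {t : T | BPcond lam t.1 t.2} := by rw [← hgr]; exact ⟨s, rfl⟩
        exact ⟨_, _, this, rfl⟩

lemma exists_BPset (lam : ℝ) (hlam : 1 < lam) (X : SB) : ∃ Y : SB, (X, Y) ∈ BPset lam := by
  haveI : Nonempty X.1 := ⟨0⟩
  obtain ⟨v, hv⟩ := exists_BPcond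
    (fun n => ((TopologicalSpace.denseSeq X.1 n : X.1) : CantorC)) lam hlam
  refine ⟨cspan v, _, v, hv, ?_⟩
  congr 1
  refine Subtype.ext (le_antisymm ?_ ?_)
  · intro w hw
    have h1 : (⟨w, hw⟩ : X.1) ∈ closure (Set.range (TopologicalSpace.denseSeq X.1)) :=
      TopologicalSpace.denseRange_denseSeq X.1 _
    have h2 := image_closure_subset_closure_image (continuous_subtype_val) ⟨_, h1, rfl⟩
    rw [← Set.range_comp] at h2
    exact closure_mono Submodule.subset_span h2
  · refine Submodule.topologicalClosure_minimal _ (Submodule.span_le.2 ?_) X.2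
    rintro _ ⟨n, rfl⟩
    exact (TopologicalSpace.denseSeq X.1 n).2

/-! ### The script L-infinity property -/

theorem linfty_of_approx {Y : Type*} [NormedAddCommGroup Y] [NormedSpace ℝ Y] [CompleteSpace Y]
    (lam : ℝ) (hlam : 1 < lam)
    (H : ∀ (m k : ℕ) (f : Fin k → Y) (ε : ℝ), 0 < ε → ∃ N, m ≤ N ∧ ∃ T : (Fin N → ℝ) →ₗ[ℝ] Y,
      (∀ a, lam⁻¹ * ‖a‖ ≤ ‖T a‖ ∧ ‖T a‖ ≤ ‖a‖) ∧ ∀ i, ∃ b, ‖f i - T b‖ < ε) :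
    IsLinftyPlus lam Y := by
  have hl0 : 0 < lam := by linarith
  intro θ hθ
  refine ⟨fun hfd => ?_, fun F hF => ?_⟩
  · obtain ⟨N, hN, T, hT, -⟩ := H (Module.finrank ℝ Y + 1) 0 (fun _ => 0) 1 one_pos
    have hinj : Function.Injective T := by
      rw [← LinearMap.ker_eq_bot, LinearMap.ker_eq_bot']
      intro a ha
      have := (hT a).1
      rw [ha, norm_zero] at this
      have h2 : ‖a‖ ≤ 0 := by
        by_contra hc
        push Not at hc
        have : 0 < lam⁻¹ * ‖a‖ := by positivity
        linarith
      exact norm_le_zero_iff.1 h2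
    have := LinearMap.finrank_le_finrank_of_injective hinj
    simp at this
    omega
  · let B := Module.finBasis ℝ F
    set d := Module.finrank ℝ F
    choose φ hφ hφn using fun i : Fin d =>
      exists_extension_norm_eq F (LinearMap.toContinuousLinearMap (B.coord i))
    set κ := (θ - lam) / (θ + lam) with hκ
    have hκ0 : 0 < κ := div_pos (by linarith) (by linarith)
    have hκ1 : κ < 1 := by rw [hκ, div_lt_one (by linarith)]; linarith
    set C := ∑ i, ‖φ i‖ with hC
    have hC0 : 0 ≤ C := Finset.sum_nonneg fun i _ => norm_nonneg _
    obtain ⟨N, -, T, hT, hb⟩ := H 0 d (fun i => (B i : Y)) (κ / (C + 1)) (by positivity)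
    choose b hb using hb
    let K : Y →L[ℝ] Y := ∑ i, (φ i).smulRight ((B i : Y) - T (b i))
    have hKn : ‖K‖ ≤ κ := by
      calc ‖K‖ ≤ ∑ i, ‖(φ i).smulRight ((B i : Y) - T (b i))‖ := norm_sum_le _ _
        _ ≤ ∑ i, ‖φ i‖ * (κ / (C + 1)) := Finset.sum_le_sum fun i _ => by
            rw [ContinuousLinearMap.norm_smulRight_apply]
            exact mul_le_mul_of_nonneg_left (hb i).le (norm_nonneg _)
        _ = κ * (C / (C + 1)) := by rw [← Finset.sum_mul]; ring
        _ ≤ κ * 1 := mul_le_mul_of_nonneg_left (by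
            rw [div_le_one (by linarith)]; linarith) hκ0.le
        _ = κ := mul_one _
    have hKB : ∀ i, K (B i : Y) = (B i : Y) - T (b i) := by
      intro i
      simp only [K, ContinuousLinearMap.sum_apply, ContinuousLinearMap.smulRight_apply, hφ]
      rw [Finset.sum_eq_single i]
      · simp
      · intro j _ hji
        simp [Finsupp.single_apply, hji.symm]
      · simp
    let u := Units.oneSub K (hKn.trans_lt hκ1)
    let S : Y →L[ℝ] Y := (u⁻¹ : (Y →L[ℝ] Y)ˣ)
    have hUS : ∀ y, S y - K (S y) = y := by
      intro y
      have : (u : Y →L[ℝ] Y) * (u⁻¹ : (Y →L[ℝ] Y)ˣ) = 1 := u.mul_inv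
      exact congrArg (fun f : Y →L[ℝ] Y => f y) this
    have hSU : ∀ y, S (y - K y) = y := by
      intro y
      have : (u⁻¹ : (Y →L[ℝ] Y)ˣ) * (u : Y →L[ℝ] Y) = 1 := u.inv_mul
      exact congrArg (fun f : Y →L[ℝ] Y => f y) this
    have hKy : ∀ y, ‖K y‖ ≤ κ * ‖y‖ := fun y => K.le_of_opNorm_le hKn y
    have hS1 : ∀ y, (1 - κ) * ‖S y‖ ≤ ‖y‖ := by
      intro y
      have h1 := norm_sub_norm_le (S y) (K (S y))
      rw [hUS] at h1
      have := hKy (S y)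
      linarith
    have hS2 : ∀ y, ‖y‖ ≤ (1 + κ) * ‖S y‖ := by
      intro y
      have h1 := norm_sub_le (S y) (K (S y))
      rw [hUS] at h1
      have := hKy (S y)
      linarith
    let ST : (Fin N → ℝ) →ₗ[ℝ] Y := S.toLinearMap ∘ₗ T
    have hST : ∀ a, ST a = S (T a) := fun a => rfl
    have hlow : ∀ a, ‖a‖ ≤ lam * (1 + κ) * ‖ST a‖ := by
      intro a
      have h1 := (hT a).1
      rw [inv_mul_le_iff₀ hl0] at h1
      have h2 := mul_le_mul_of_nonneg_left (hS2 (T a)) hl0.le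
      rw [hST]
      linarith
    have hup : ∀ a, ‖ST a‖ ≤ (1 - κ)⁻¹ * ‖a‖ := by
      intro a
      rw [hST, le_inv_mul_iff₀ (by linarith)]
      exact (hS1 _).trans (hT a).2
    have hinj : Function.Injective ST := by
      rw [← LinearMap.ker_eq_bot, LinearMap.ker_eq_bot']
      intro a ha
      have := hlow a
      rw [ha, norm_zero, mul_zero] at this
      exact norm_le_zero_iff.1 this
    let E := LinearEquiv.ofInjective ST hinj
    refine ⟨LinearMap.range ST, ?_, inferInstance, ?_⟩
    · intro y hy
      have h1 := B.sum_repr ⟨y, hy⟩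
      have h2 := congrArg (Subtype.val) h1
      simp only [Submodule.coe_sum, Submodule.coe_smul] at h2
      rw [← h2]
      refine Submodule.sum_mem _ fun i _ => Submodule.smul_mem _ _ ⟨b i, ?_⟩
      rw [hST, ← hSU (B i : Y), hKB, sub_sub_cancel]
    · have hfr : Module.finrank ℝ (LinearMap.range ST) = N := by
        rw [LinearMap.finrank_range_of_inj hinj]; simp
      rw [hfr]
      intro θ' hθ'
      refine ⟨E.symm.toContinuousLinearEquiv, ?_⟩
      have hn1 : ‖(E.symm.toContinuousLinearEquiv : LinearMap.range ST →L[ℝ] (Fin N → ℝ))‖ ≤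
          lam * (1 + κ) := by
        refine ContinuousLinearMap.opNorm_le_bound _ (by positivity) fun y => ?_
        have h1 := hlow (E.symm y)
        have h2 : ST (E.symm y) = y := congrArg Subtype.val (E.apply_symm_apply y)
        rw [h2] at h1
        exact h1
      have hn2 : ‖(E.symm.toContinuousLinearEquiv.symm : (Fin N → ℝ) →L[ℝ] LinearMap.range ST)‖ ≤
          (1 - κ)⁻¹ :=
        ContinuousLinearMap.opNorm_le_bound _ (inv_nonneg.2 (by linarith)) fun a => hup a
      refine (mul_le_mul hn1 hn2 (ContinuousLinearMap.opNorm_nonneg _) (by positivity)).trans ?_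
      refine le_trans (le_of_eq ?_) hθ'.le
      have : θ + lam ≠ 0 := by linarith
      have h3 : 1 - κ = 2 * lam / (θ + lam) := by rw [hκ]; field_simp; ring
      rw [h3, hκ]
      field_simp
      ring

/-! ### Properties of the coded spaces -/

lemma exists_qc {ι W : Type*} [SeminormedAddCommGroup W] [NormedSpace ℝ W] (v : ι → W)
    (a : ι →₀ ℝ) : ∀ ε : ℝ, 0 < ε → ∃ q : ι →₀ ℚ, (∀ i, a i = 0 → q i = 0) ∧
      ‖Finsupp.linearCombination ℝ v a - Finsupp.linearCombination ℝ v (qc q)‖ < ε := by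
  classical
  induction a using Finsupp.induction with
  | zero =>
    intro ε hε
    refine ⟨0, fun _ _ => rfl, ?_⟩
    have : qc (0 : ι →₀ ℚ) = 0 := by simp [qc]
    rw [this, sub_self, norm_zero]
    exact hε
  | single_add i r f hi hr ih =>
    intro ε hε
    obtain ⟨q, hq, hqn⟩ := ih (ε / 2) (by linarith)
    have hpos : 0 < ε / 2 / (‖v i‖ + 1) := by positivity
    obtain ⟨s, hs1, hs2⟩ := exists_rat_btwn (show r < r + ε / 2 / (‖v i‖ + 1) by linarith)
    have hfi : f i = 0 := Finsupp.notMem_support_iff.1 hi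
    refine ⟨Finsupp.single i s + q, ?_, ?_⟩
    · intro j hj
      have hij : i ≠ j := by
        rintro rfl
        simp [hfi, hr] at hj
      rw [Finsupp.add_apply, Finsupp.single_eq_of_ne hij.symm, zero_add] at hj ⊢
      exact hq j hj
    · have h1 : qc (Finsupp.single i s + q) = Finsupp.single i (s : ℝ) + qc q := by
        ext j
        simp only [qc, Finsupp.mapRange_apply, Finsupp.add_apply, Finsupp.single_apply]
        split_ifs <;> simp
      rw [h1, map_add, map_add, Finsupp.linearCombination_single, Finsupp.linearCombination_single]
      have h2 : r • v i + Finsupp.linearCombination ℝ v f -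
          ((s : ℝ) • v i + Finsupp.linearCombination ℝ v (qc q)) =
          (r - (s : ℝ)) • v i +
            (Finsupp.linearCombination ℝ v f - Finsupp.linearCombination ℝ v (qc q)) := by
        rw [sub_smul]; abel
      rw [h2]
      have h3 : ‖(r - (s : ℝ)) • v i‖ ≤ ε / 2 := by
        rw [norm_smul, Real.norm_eq_abs, abs_sub_comm, abs_of_pos (by linarith)]
        have h4 : (s : ℝ) - r ≤ ε / 2 / (‖v i‖ + 1) := by linarith
        calc ((s : ℝ) - r) * ‖v i‖ ≤ ε / 2 / (‖v i‖ + 1) * (‖v i‖ + 1) :=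
              mul_le_mul h4 (by linarith) (norm_nonneg _) hpos.le
          _ = ε / 2 := by field_simp
      calc _ ≤ _ := norm_add_le _ _
        _ < ε := by linarith

/-- Span of the generators of level at most `n`. -/
def levSpan {W : Type*} [SeminormedAddCommGroup W] [NormedSpace ℝ W] (v : GenIx → W) (n : ℕ) :
    Submodule ℝ W := Submodule.span ℝ (v '' {i | lev i ≤ n})

lemma mem_levSpan {W : Type*} [SeminormedAddCommGroup W] [NormedSpace ℝ W] (v : GenIx → W) (n : ℕ)
    (y : W) : y ∈ levSpan v n ↔
      ∃ a : GenIx →₀ ℝ, levProj n a = a ∧ Finsupp.linearCombination ℝ v a = y := by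
  rw [levSpan, Finsupp.mem_span_image_iff_linearCombination]
  refine exists_congr fun a => and_congr_left fun _ => ?_
  rw [Finsupp.mem_supported, levProj_eq_self_iff]
  constructor
  · intro h i hi
    by_contra hc
    have := h (Finsupp.mem_support_iff.2 hc)
    have h2 : lev i ≤ n := this
    omega
  · intro h i hi
    have : a i ≠ 0 := Finsupp.mem_support_iff.1 hi
    change lev i ≤ n
    by_contra hc
    exact this (h i (by omega))

lemma chain_of_BPcond (lam : ℝ) (hlam : 1 < lam) {V W : Type*} [SeminormedAddCommGroup V]
    [NormedSpace ℝ V] [SeminormedAddCommGroup W] [NormedSpace ℝ W] (x : ℕ → V) (v : GenIx → W)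
    (hv : DenseRange (Finsupp.linearCombination ℝ v)) (h : BPcond lam x v)
    (n m : ℕ) (z : Fin m → W) (y : W) (hy : y ∈ levSpan v n) (ε : ℝ) (hε : 0 < ε) :
    ∃ u : Fin m → W, (∀ i, u i ∈ levSpan v n) ∧
      ‖∑ i, z i‖ + (1 - 1 / Real.sqrt lam) * ∑ i, ‖z i - u i‖ ≤
        ∑ i, ‖z i‖ + 2 * ‖∑ i, z i - y‖ + ε := by
  obtain ⟨-, -, h3, -⟩ := h
  set δ := 1 - 1 / Real.sqrt lam with hδ
  have hsq : 1 < Real.sqrt lam := by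
    rw [Real.lt_sqrt (by norm_num)]; simpa using hlam
  have hδ0 : 0 ≤ δ := by
    have : 1 / Real.sqrt lam ≤ 1 := by rw [div_le_one (by linarith)]; exact hsq.le
    linarith
  have hδ1 : δ ≤ 1 := by
    have : 0 ≤ 1 / Real.sqrt lam := by positivity
    linarith
  set η := ε / (5 * m + 3) with hη
  have hη0 : 0 < η := by positivity
  have hηm : (5 * m + 3) * η = ε := by rw [hη]; field_simp
  have happ : ∀ w : W, ∃ q : GenIx →₀ ℚ, ‖w - Finsupp.linearCombination ℝ v (qc q)‖ < η := by
    intro w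
    obtain ⟨a, ha⟩ := hv.exists_dist_lt w (half_pos hη0)
    obtain ⟨q, -, hq⟩ := exists_qc v a (η / 2) (half_pos hη0)
    refine ⟨q, ?_⟩
    rw [dist_eq_norm] at ha
    calc _ = ‖(w - Finsupp.linearCombination ℝ v a) + (Finsupp.linearCombination ℝ v a -
          Finsupp.linearCombination ℝ v (qc q))‖ := by rw [sub_add_sub_cancel]
      _ ≤ _ := norm_add_le _ _
      _ < η := by linarith
  choose q hq using fun i => happ (z i)
  obtain ⟨a, ha, hay⟩ := (mem_levSpan v n y).1 hy
  obtain ⟨r, hr0, hr⟩ := exists_qc v a η hη0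
  have hrl : levProj n (qc r) = qc r := by
    rw [levProj_eq_self_iff] at ha ⊢
    intro i hi
    simp [qc, hr0 i (ha i hi)]
  obtain ⟨k, hk⟩ := exists_nat_one_div_lt hη0
  obtain ⟨u, hu, hle⟩ := h3 n m q r hrl k
  refine ⟨fun i => Finsupp.linearCombination ℝ v (u i), fun i =>
    (mem_levSpan v n _).2 ⟨u i, hu i, rfl⟩, ?_⟩
  rw [hay] at hr
  simp only [map_sub, map_sum] at hle
  set Z : Fin m → W := fun i => Finsupp.linearCombination ℝ v (qc (q i)) with hZ
  have hsum : ‖∑ i, z i - ∑ i, Z i‖ ≤ m * η := by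
    rw [← Finset.sum_sub_distrib]
    refine (norm_sum_le _ _).trans ((Finset.sum_le_sum fun i _ => (hq i).le).trans ?_)
    simp
  have e1 : ‖∑ i, z i‖ ≤ ‖∑ i, Z i‖ + m * η := by
    have := norm_sub_norm_le (∑ i, z i) (∑ i, Z i)
    linarith
  have e2 : ∑ i, ‖z i - Finsupp.linearCombination ℝ v (u i)‖ ≤
      ∑ i, ‖Z i - Finsupp.linearCombination ℝ v (u i)‖ + m * η := by
    have : ∑ i, ‖z i - Finsupp.linearCombination ℝ v (u i)‖ ≤
        ∑ i, (‖Z i - Finsupp.linearCombination ℝ v (u i)‖ + η) := by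
      refine Finset.sum_le_sum fun i _ => ?_
      have h1 := norm_add_le (z i - Z i) (Z i - Finsupp.linearCombination ℝ v (u i))
      rw [sub_add_sub_cancel] at h1
      have := hq i
      linarith
    rw [Finset.sum_add_distrib] at this
    simpa using this
  have e3 : ∑ i, ‖Z i‖ ≤ ∑ i, ‖z i‖ + m * η := by
    have : ∑ i, ‖Z i‖ ≤ ∑ i, (‖z i‖ + η) := by
      refine Finset.sum_le_sum fun i _ => ?_
      have h1 := norm_sub_norm_le (Z i) (z i)
      rw [norm_sub_rev] at h1
      have := hq i
      linarith
    rw [Finset.sum_add_distrib] at this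
    simpa using this
  have e4 : ‖∑ i, Z i - Finsupp.linearCombination ℝ v (qc r)‖ ≤ ‖∑ i, z i - y‖ + (m + 1) * η := by
    have h1 : ∑ i, Z i - Finsupp.linearCombination ℝ v (qc r) =
        (∑ i, z i - y) + (-(∑ i, z i - ∑ i, Z i) + (y - Finsupp.linearCombination ℝ v (qc r))) := by
      abel
    rw [h1]
    refine (norm_add_le _ _).trans ?_
    have h2 := norm_add_le (-(∑ i, z i - ∑ i, Z i)) (y - Finsupp.linearCombination ℝ v (qc r))
    rw [norm_neg] at h2
    linarith
  have e5 := mul_le_mul_of_nonneg_left e2 hδ0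
  have e6 : δ * (m * η) ≤ m * η := mul_le_of_le_one_left (by positivity) hδ1
  have e7 : 0 ≤ (m : ℝ) * η := by positivity
  rw [mul_add] at e5
  linarith

lemma chainIneq_quot {W : Type*} [SeminormedAddCommGroup W] [NormedSpace ℝ W] (R D : Submodule ℝ W)
    (hR : R ≤ D.topologicalClosure) (δ : ℝ) (hδ : 0 ≤ δ)
    (h : ∀ m (z : Fin m → W), ∀ y ∈ D, ∀ ε : ℝ, 0 < ε → ∃ u : Fin m → W, (∀ i, u i ∈ D) ∧
      ‖∑ i, z i‖ + δ * ∑ i, ‖z i - u i‖ ≤ ∑ i, ‖z i‖ + 2 * ‖∑ i, z i - y‖ + ε) :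
    ChainIneq δ (D.map R.mkQ) := by
  intro m z
  refine le_of_forall_pos_le_add fun ε hε => ?_
  set η := ε / (m + 7) with hη
  have hη0 : 0 < η := by positivity
  have hηm : (m + 7) * η = ε := by rw [hη]; field_simp
  choose y hy hyn using fun i => Submodule.Quotient.norm_mk_lt (S := R) (z i) hη0
  obtain ⟨e', ⟨e, he, rfl⟩, hen⟩ := exists_dS_lt (D.map R.mkQ) (∑ i, z i) hη0
  have hzs : ∑ i, z i = R.mkQ (∑ i, y i) := by
    rw [map_sum]; exact Finset.sum_congr rfl fun i _ => (hy i).symm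
  obtain ⟨w, hw, hwn⟩ := Submodule.Quotient.norm_mk_lt (S := R) (∑ i, z i - R.mkQ e) hη0
  have hwR : (∑ i, y i - e) - w ∈ R := by
    rw [← Submodule.Quotient.mk_eq_zero, Submodule.Quotient.mk_sub, hw, hzs]
    exact sub_self _
  have hcl : e + ((∑ i, y i - e) - w) ∈ D.topologicalClosure :=
    Submodule.add_mem _ (D.le_topologicalClosure he) (hR hwR)
  obtain ⟨d, hd, hdn⟩ := Metric.mem_closure_iff.1 hcl η hη0
  obtain ⟨u, hu, hle⟩ := h m y d hd η hη0
  rw [dist_eq_norm] at hdn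
  have e1 : ‖∑ i, z i‖ ≤ ‖∑ i, y i‖ := by
    rw [hzs]; exact Submodule.Quotient.norm_mk_le R _
  have e2 : ∑ i, dS (D.map R.mkQ) (z i) ≤ ∑ i, ‖y i - u i‖ := by
    refine Finset.sum_le_sum fun i _ => ?_
    refine (dS_le _ (z i) (Submodule.mem_map_of_mem (f := R.mkQ) (hu i))).trans ?_
    rw [← hy i]
    exact Submodule.Quotient.norm_mk_le R (y i - u i)
  have e3 : ∑ i, ‖y i‖ ≤ ∑ i, ‖z i‖ + m * η := by
    have : ∑ i, ‖y i‖ ≤ ∑ i, (‖z i‖ + η) := Finset.sum_le_sum fun i _ => (hyn i).le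
    rw [Finset.sum_add_distrib] at this
    simpa using this
  have e4 : ‖∑ i, y i - d‖ ≤ dS (D.map R.mkQ) (∑ i, z i) + 3 * η := by
    have h1 : ∑ i, y i - d = w + (e + ((∑ i, y i - e) - w) - d) := by abel
    rw [h1]
    refine (norm_add_le _ _).trans ?_
    linarith
  have e5 := mul_le_mul_of_nonneg_left e2 hδ
  linarith

theorem bp_main (lam : ℝ) (hlam : 1 < lam) {X Y : Type*} [NormedAddCommGroup X] [NormedSpace ℝ X]
    [CompleteSpace X] [NormedAddCommGroup Y] [NormedSpace ℝ Y] [CompleteSpace Y]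
    (x : ℕ → X) (v : GenIx → Y) (hx : DenseRange (Finsupp.linearCombination ℝ x))
    (hv : DenseRange (Finsupp.linearCombination ℝ v)) (h : BPcond lam x v) :
    ∃ j : X →ₗᵢ[ℝ] Y,
      IsLinftyPlus lam Y ∧
      IsClosed ((LinearMap.range j.toLinearMap : Submodule ℝ Y) : Set Y) ∧
      HasSchurProperty (Y ⧸ LinearMap.range j.toLinearMap) ∧
      ∀ (_hcl : IsClosed ((LinearMap.range j.toLinearMap : Submodule ℝ Y) : Set Y)),
        HasRNP (Y ⧸ LinearMap.range j.toLinearMap) := by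
  classical
  have hsq : 1 < Real.sqrt lam := by
    rw [Real.lt_sqrt (by norm_num)]; simpa using hlam
  have hδ0 : 0 < 1 - 1 / Real.sqrt lam := by
    have : 1 / Real.sqrt lam < 1 := by rw [div_lt_one (by linarith)]; exact hsq
    linarith
  obtain ⟨h1, h2, h3, h4⟩ := id h
  -- the embedding
  obtain ⟨j, hj⟩ : ∃ j : X →ₗᵢ[ℝ] Y, ∀ i, j (x i) = v (Sum.inl i) := by
    let f : (ℕ →₀ ℝ) →ₗ[ℝ] Y := Finsupp.linearCombination ℝ (fun i => v (Sum.inl i))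
    let e : (ℕ →₀ ℝ) →ₗ[ℝ] X := Finsupp.linearCombination ℝ x
    have hfe : ∀ q, ‖f q‖ = ‖e q‖ := by
      intro q
      rw [← h1 q, Finsupp.linearCombination_mapDomain]
      rfl
    have heq := LinearMap.extendOfNorm_eq (f := f) (e := e) hx ⟨1, fun q => by rw [hfe, one_mul]⟩
    refine ⟨⟨(f.extendOfNorm e).toLinearMap, ?_⟩, fun i => ?_⟩
    · refine hx.induction ?_ (isClosed_eq (f.extendOfNorm e).continuous.norm continuous_norm)
      rintro _ ⟨q, rfl⟩
      change ‖f.extendOfNorm e (e q)‖ = ‖e q‖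
      rw [heq, hfe]
    · have h5 := heq (Finsupp.single i 1)
      simpa [e, f] using h5
  have hclR : IsClosed ((LinearMap.range j.toLinearMap : Submodule ℝ Y) : Set Y) := by
    have : ((LinearMap.range j.toLinearMap : Submodule ℝ Y) : Set Y) = Set.range j := by
      ext y; simp
    rw [this]
    exact j.isometry.isClosedEmbedding.isClosed_range
  set R := LinearMap.range j.toLinearMap with hR
  have hRj : ∀ i, v (Sum.inl i) ∈ R := fun i => ⟨x i, hj i⟩
  have hRcl : ∀ n, R ≤ (levSpan v n).topologicalClosure := by
    rintro n _ ⟨w, rfl⟩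
    have hc : IsClosed {w | j w ∈ (levSpan v n).topologicalClosure} :=
      (Submodule.isClosed_topologicalClosure _).preimage j.continuous
    refine hx.induction (P := fun w => j w ∈ (levSpan v n).topologicalClosure) ?_ hc w
    rintro _ ⟨q, rfl⟩
    refine (levSpan v n).le_topologicalClosure ?_
    rw [Finsupp.linearCombination_apply, Finsupp.sum, map_sum]
    refine Submodule.sum_mem _ fun i _ => ?_
    rw [map_smul, hj]
    exact Submodule.smul_mem _ _ (Submodule.subset_span ⟨_, Nat.zero_le _, rfl⟩)
  have hchain : HasChain (Y ⧸ R) (1 - 1 / Real.sqrt lam) := by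
    refine ⟨fun n => (levSpan v n).map R.mkQ, fun n => ?_, fun n => ?_, ?_, ?_⟩
    · choose K hK using h2
      have : (levSpan v n).map R.mkQ = Submodule.span ℝ (R.mkQ '' (v '' {i | lev i ≤ n})) := by
        rw [levSpan, Submodule.map_span]
      change FiniteDimensional ℝ ((levSpan v n).map R.mkQ)
      rw [this]
      refine FiniteDimensional.span_of_finite ℝ ?_
      have hfin : (insert 0 (⋃ k ∈ Set.Iio n, (fun i => R.mkQ (v (Sum.inr (k, i)))) '' Set.Iio (K k)) :
          Set (Y ⧸ R)).Finite :=
        Set.Finite.insert _ ((Set.finite_Iio n).biUnion fun k _ => (Set.finite_Iio _).image _)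
      refine hfin.subset ?_
      rintro _ ⟨_, ⟨i, hi, rfl⟩, rfl⟩
      rcases i with i | ⟨k, i⟩
      · left
        exact (Submodule.Quotient.mk_eq_zero R).2 (hRj i)
      · by_cases hik : i < K k
        · right
          exact Set.mem_biUnion (show k ∈ Set.Iio n from hi) ⟨i, hik, rfl⟩
        · left
          rw [norm_eq_zero.1 (hK k i (by omega)), map_zero]
    · exact chainIneq_quot R (levSpan v n) (hRcl n) _ hδ0.le
        (fun m z y hy ε hε => chain_of_BPcond lam hlam x v hv h n m z y hy ε hε)
    · intro n m hnm
      exact Submodule.map_mono (Submodule.span_mono (Set.image_mono fun i hi => le_trans hi hnm))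
    · intro z ε hε
      obtain ⟨y, rfl⟩ := Submodule.mkQ_surjective R z
      obtain ⟨a, ha⟩ := hv.exists_dist_lt y hε
      refine ⟨a.support.sup lev, ?_⟩
      have hmem : Finsupp.linearCombination ℝ v a ∈ levSpan v (a.support.sup lev) := by
        rw [mem_levSpan]
        refine ⟨a, ?_, rfl⟩
        rw [levProj_eq_self_iff]
        intro i hi
        by_contra hc
        have := Finset.le_sup (f := lev) (Finsupp.mem_support_iff.2 hc)
        omega
      refine (dS_le _ _ (Submodule.mem_map_of_mem (f := R.mkQ) hmem)).trans_lt ?_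
      rw [dist_eq_norm] at ha
      exact (Submodule.Quotient.norm_mk_le R (y - Finsupp.linearCombination ℝ v a)).trans_lt ha
  refine ⟨j, ?_, hclR, ?_, ?_⟩
  · -- script L-infinity
    refine linfty_of_approx lam hlam fun m k f ε hε => ?_
    choose a ha using fun i => hv.exists_dist_lt (f i) (half_pos hε)
    have hev : ∀ᶠ M : ℕ in atTop, m ≤ M ∧ (∀ i, ∀ l ∈ (a i).support, Encodable.encode l < M) ∧
        ∀ i, (∑ l ∈ (a i).support, |a i l|) * (1 / ((M : ℝ) + 1)) < ε / 2 := by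
      refine (eventually_ge_atTop m).and (Filter.Eventually.and ?_ ?_)
      · refine eventually_all.2 fun i => (Finset.eventually_all _).2 fun l _ => eventually_gt_atTop _
      · refine eventually_all.2 fun i => ?_
        have := (tendsto_one_div_add_atTop_nhds_zero_nat (𝕜 := ℝ)).const_mul
          (∑ l ∈ (a i).support, |a i l|)
        rw [mul_zero] at this
        exact this.eventually_lt_const (half_pos hε)
    obtain ⟨M, hM1, hM2, hM3⟩ := hev.exists
    obtain ⟨n, N, hMN, hN, hb⟩ := h4 M
    refine ⟨N, hM1.trans hMN, blk v n N, hN, fun i => ?_⟩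
    choose! b hb using hb
    refine ⟨∑ l ∈ (a i).support, a i l • b l, ?_⟩
    have h5 : ‖Finsupp.linearCombination ℝ v (a i) -
        blk v n N (∑ l ∈ (a i).support, a i l • b l)‖ < ε / 2 := by
      rw [Finsupp.linearCombination_apply, Finsupp.sum, map_sum, ← Finset.sum_sub_distrib]
      refine lt_of_le_of_lt ?_ (hM3 i)
      rw [Finset.sum_mul]
      refine (norm_sum_le _ _).trans (Finset.sum_le_sum fun l hl => ?_)
      rw [map_smul, ← smul_sub, norm_smul, Real.norm_eq_abs]
      exact mul_le_mul_of_nonneg_left (hb l (hM2 i l hl)).le (abs_nonneg _)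
    have h6 := ha i
    rw [dist_eq_norm] at h6
    calc _ = ‖(f i - Finsupp.linearCombination ℝ v (a i)) + (Finsupp.linearCombination ℝ v (a i) -
        blk v n N (∑ l ∈ (a i).support, a i l • b l))‖ := by rw [sub_add_sub_cancel]
      _ ≤ _ := norm_add_le _ _
      _ < ε := by linarith
  · haveI := hclR
    exact hasSchur_of_hasChain hδ0 hchain
  · intro _hcl
    exact hasRNP_of_hasChain hδ0 hchain

lemma BPcond_comp (lam : ℝ) {V W V' W' : Type*} [SeminormedAddCommGroup V]
    [NormedSpace ℝ V] [SeminormedAddCommGroup W] [NormedSpace ℝ W] [SeminormedAddCommGroup V']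
    [NormedSpace ℝ V'] [SeminormedAddCommGroup W'] [NormedSpace ℝ W'] (f : V →ₗᵢ[ℝ] V')
    (g : W →ₗᵢ[ℝ] W') (x : ℕ → V) (v : GenIx → W)
    (h : BPcond lam (fun i => f (x i)) (fun i => g (v i))) : BPcond lam x v := by
  have hf : ∀ q, Finsupp.linearCombination ℝ (fun i => f (x i)) q =
      f (Finsupp.linearCombination ℝ x q) := fun q => by
    simp [Finsupp.linearCombination_apply, Finsupp.sum, map_sum]
  have hg : ∀ q, Finsupp.linearCombination ℝ (fun i => g (v i)) q =
      g (Finsupp.linearCombination ℝ v q) := fun q => by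
    simp [Finsupp.linearCombination_apply, Finsupp.sum, map_sum]
  have hb : ∀ n N a, blk (fun i => g (v i)) n N a = g (blk v n N a) := fun n N a => by
    simp [blk_apply, map_sum]
  unfold BPcond at h ⊢
  simp only [hf, hg, hb, ← map_sub, LinearIsometry.norm_map] at h
  exact h

lemma dense_cspan {ι : Type*} (v : ι → CantorC) (Y : SB) (hY : Y = cspan v) (w : ι → Y.1)
    (hw : ∀ i, (w i : CantorC) = v i) : DenseRange (Finsupp.linearCombination ℝ w) := by
  have hg : ∀ q, ((Finsupp.linearCombination ℝ w q : Y.1) : CantorC) =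
      Finsupp.linearCombination ℝ v q := fun q => by
    simp [Finsupp.linearCombination_apply, Finsupp.sum, hw]
  intro y
  rw [Metric.mem_closure_iff]
  intro ε hε
  have hy : (y : CantorC) ∈ closure (Submodule.span ℝ (Set.range v) : Set CantorC) := by
    have h2 : (y : CantorC) ∈ (cspan v).1 := hY ▸ y.2
    exact h2
  obtain ⟨z, hz, hzn⟩ := Metric.mem_closure_iff.1 hy ε hε
  obtain ⟨q, rfl⟩ := Finsupp.mem_span_range_iff_exists_finsupp.1 hz
  refine ⟨_, ⟨q, rfl⟩, ?_⟩
  rw [Subtype.dist_eq, hg]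
  exact hzn

theorem bp_coded (lam : ℝ) (hlam : 1 < lam) (X Y : SB) (x : ℕ → CantorC) (v : GenIx → CantorC)
    (h : BPcond lam x v) (hX : X = cspan x) (hY : Y = cspan v) :
    ∃ j : ↥X.1 →ₗᵢ[ℝ] ↥Y.1,
      IsLinftyPlus lam ↥Y.1 ∧
      IsClosed ((LinearMap.range j.toLinearMap : Submodule ℝ ↥Y.1) : Set ↥Y.1) ∧
      HasSchurProperty (↥Y.1 ⧸ LinearMap.range j.toLinearMap) ∧
      ∀ (_hcl : IsClosed
          ((LinearMap.range j.toLinearMap : Submodule ℝ ↥Y.1) : Set ↥Y.1)),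
        HasRNP (↥Y.1 ⧸ LinearMap.range j.toLinearMap) := by
  have hmem : ∀ {ι : Type} (w : ι → CantorC) i, w i ∈ (cspan w).1 := fun w i =>
    Submodule.le_topologicalClosure _ (Submodule.subset_span ⟨i, rfl⟩)
  haveI : CompleteSpace X.1 := X.2.completeSpace_coe
  haveI : CompleteSpace Y.1 := Y.2.completeSpace_coe
  obtain ⟨x', hx'⟩ : ∃ x' : ℕ → X.1, ∀ i, (x' i : CantorC) = x i :=
    ⟨fun i => ⟨x i, by rw [hX]; exact hmem x i⟩, fun _ => rfl⟩
  obtain ⟨v', hv'⟩ : ∃ v' : GenIx → Y.1, ∀ i, (v' i : CantorC) = v i :=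
    ⟨fun i => ⟨v i, by rw [hY]; exact hmem v i⟩, fun _ => rfl⟩
  have hdx : DenseRange (Finsupp.linearCombination ℝ x') := dense_cspan x X hX x' hx'
  have hdv : DenseRange (Finsupp.linearCombination ℝ v') := dense_cspan v Y hY v' hv'
  have hc : BPcond lam x' v' := by
    refine BPcond_comp lam X.1.subtypeₗᵢ Y.1.subtypeₗᵢ x' v' ?_
    have e1 : (fun i => X.1.subtypeₗᵢ (x' i)) = x := funext hx'
    have e2 : (fun i => Y.1.subtypeₗᵢ (v' i)) = v := funext hv'
    rw [e1, e2]
    exact h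
  exact bp_main lam hlam x' v' hdx hdv hc

/-- **Theorem (parameterized Bourgain-Pisier construction).** For every `λ > 1` there
is an analytic subset `𝓛_λ` of `SB × SB` such that: (a) every `X ∈ SB` admits some `Y`
with `(X,Y) ∈ 𝓛_λ`; (b) whenever `(X,Y) ∈ 𝓛_λ`, `X` embeds isometrically into `Y`,
`Y` is a (separable) `𝓛_{∞,λ+}`-space, and the quotient `Y/X` has the Schur property
and the Radon-Nikodym property. -/
theorem bourgain_pisier_parameterized (lam : ℝ) (hlam : 1 < lam) :
    ∃ L : Set (SB × SB), IsAnalyticIn L ∧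
      (∀ X : SB, ∃ Y : SB, (X, Y) ∈ L) ∧
      (∀ X Y : SB, (X, Y) ∈ L →
        ∃ j : ↥X.1 →ₗᵢ[ℝ] ↥Y.1,
          IsLinftyPlus lam ↥Y.1 ∧
          IsClosed ((LinearMap.range j.toLinearMap : Submodule ℝ ↥Y.1) : Set ↥Y.1) ∧
          HasSchurProperty (↥Y.1 ⧸ LinearMap.range j.toLinearMap) ∧
          ∀ (_hcl : IsClosed
              ((LinearMap.range j.toLinearMap : Submodule ℝ ↥Y.1) : Set ↥Y.1)),
            HasRNP (↥Y.1 ⧸ LinearMap.range j.toLinearMap)) := by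
  refine ⟨BPset lam, isAnalytic_BPset lam hlam, exists_BPset lam hlam, ?_⟩
  rintro X Y ⟨x, v, h, hXY⟩
  exact bp_coded lam hlam X Y x v h (Prod.mk.inj hXY).1 (Prod.mk.inj hXY).2
end
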